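/- There is no algorithm which, given a term t(x₁,…,x₅) in five variables in the language of ortholattices (built from the variables and constants 0, 1 by the operations ⊔, ⊓, and ^⊥), decides whether there exist a finite d ≥ 1 and linear subspaces U₁,…,U₅ of the complex Hilbert space ℂ^d such that t(U₁,…,U₅) = ℂ^d, where ⊓ is interpreted as intersection of subspaces, ⊔ as sum of subspaces, ^⊥ as orthogonal complement with respect to the standard inner product, 0 as the zero subspace, and 1 as ℂ^d. Equivalently, the set of such ortholattice terms t for which ∃x̄. t(x̄) = 1 holds in the ortholattice of subspaces of ℂ^d for some d ≥ 1 is not decidable. -/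

import Mathlib

/-- Ortholattice terms in five variables: built from the variables and the
constants `0`, `1` by `⊔`, `⊓` and orthocomplement `ᗮ`. -/
inductive OLTerm : Type where
  | var : Fin 5 → OLTerm
  | zero : OLTerm
  | one : OLTerm
  | sup : OLTerm → OLTerm → OLTerm
  | inf : OLTerm → OLTerm → OLTerm
  | compl : OLTerm → OLTerm

/-- Evaluation of an ortholattice term on subspaces of the complex Hilbert
space `ℂ^d`: `⊓` is intersection, `⊔` is sum of subspaces, `ᗮ` is orthogonal
complement, `0` is the zero subspace and `1` is the whole space. -/
noncomputable def OLTerm.eval {d : ℕ} (v : Fin 5 → Submodule ℂ (EuclideanSpace ℂ (Fin d))) :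
    OLTerm → Submodule ℂ (EuclideanSpace ℂ (Fin d))
  | .var i => v i
  | .zero => ⊥
  | .one => ⊤
  | .sup s t => s.eval v ⊔ t.eval v
  | .inf s t => s.eval v ⊓ t.eval v
  | .compl s => (s.eval v)ᗮ

/-- An injective Gödel numbering of ortholattice terms. -/
def OLTerm.code : OLTerm → ℕ
  | .var i => 6 * i.1
  | .zero => 1
  | .one => 2
  | .sup s t => 6 * Nat.pair s.code t.code + 3
  | .inf s t => 6 * Nat.pair s.code t.code + 4
  | .compl s => 6 * s.code + 5

open Turing StateTransition

theorem Turing.PartrecToTM2.trNat_two_pow_sub_one (k : ℕ) :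
    PartrecToTM2.trNat (2 ^ k - 1) = List.replicate k PartrecToTM2.Γ'.bit1 := by
  induction k with
  | zero => rfl
  | succ k ih =>
    have h : 2 ^ (k + 1) - 1 = 2 * (2 ^ k - 1) + 1 := by
      have := Nat.one_le_two_pow (n := k); omega
    rw [h, List.replicate_succ, ← ih]
    generalize 2 ^ k - 1 = m
    simp only [PartrecToTM2.trNat]
    have : ((2 * m + 1 : ℕ) : Num) = Num.bit1 (m : Num) := by
      rw [← Num.of_to_nat (Num.bit1 (m : Num))]
      congr 1
      simp
    rw [this]
    cases (m : Num) <;> rfl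

theorem exists_partrec_halting_two_pow :
    ∃ p : ℕ →. ℕ, Partrec p ∧ ¬ ComputablePred fun k : ℕ => (p (2 ^ k - 1)).Dom := by
  have hg : Primrec fun k : ℕ => 2 ^ k - 1 := by
    have : Primrec fun k : ℕ => Nat.rec (motive := fun _ => ℕ) 0 (fun _ r => 2 * r + 1) k :=
      Primrec.nat_rec' Primrec.id (Primrec.const 0)
        (Primrec.succ.comp (Primrec.nat_mul.comp (Primrec.const 2)
          (Primrec.snd.comp Primrec.snd))).to₂
    refine this.of_eq fun k => ?_
    induction k with
    | zero => rfl
    | succ k ih =>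
      simp only [ih]
      have := Nat.one_le_two_pow (n := k)
      omega
  have hinj : Function.Injective fun k : ℕ => 2 ^ k - 1 := fun a b h => by
    have h1 := Nat.one_le_two_pow (n := a)
    have h2 := Nat.one_le_two_pow (n := b)
    simp only at h
    exact Nat.pow_right_injective le_rfl (show 2 ^ a = 2 ^ b by omega)
  refine ⟨fun m => (Nat.rfind fun k => Part.some (decide (2 ^ k - 1 = m))).bind
    fun k => Nat.Partrec.Code.eval (Denumerable.ofNat Nat.Partrec.Code k) 0, ?_, fun h => ?_⟩
  · refine Partrec.bind (Partrec.rfind ?_) ?_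
    · exact (Primrec.eq.decide.comp (hg.comp Primrec.snd) Primrec.fst).to_comp.partrec
    · exact Nat.Partrec.Code.eval_part.comp
        ((Computable.ofNat _).comp Computable.snd) (Computable.const 0)
  · refine ComputablePred.halting_problem 0 ?_
    refine ComputablePred.computable_of_manyOneReducible
      ⟨Encodable.encode, Computable.encode, fun c => ?_⟩ h
    have : (Nat.rfind fun k => Part.some (decide (2 ^ k - 1 = 2 ^ Encodable.encode c - 1))) =
        Part.some (Encodable.encode c) := by
      refine Part.eq_some_iff.2 (Nat.mem_rfind.2 ⟨by simp, fun {m} hm => ?_⟩)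
      have : m ≠ Encodable.encode c := hm.ne
      simpa using fun h => this (hinj h)
    beta_reduce
    rw [this]
    simp

theorem exists_code_halting_two_pow :
    ∃ c : ToPartrec.Code, ¬ ComputablePred fun k : ℕ => (c.eval [2 ^ k - 1]).Dom := by
  obtain ⟨p, hp, hnot⟩ := exists_partrec_halting_two_pow
  obtain ⟨c, hc⟩ := ToPartrec.Code.exists_code (Nat.Partrec'.part_iff₁.2 hp)
  refine ⟨c, fun h => hnot (h.of_eq fun k => ?_)⟩
  have := hc (⟨[2 ^ k - 1], rfl⟩ : List.Vector ℕ 1)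
  simp only at this
  rw [this]
  rfl

theorem exists_postTuringMachine_halting :
    ∃ (Γ Λ : Type) (_ : Inhabited Γ) (_ : Fintype Γ) (_ : Inhabited Λ) (M : TM0.Machine Γ Λ)
      (S : Finset Λ) (a b : Γ), TM0.Supports M (S : Set Λ) ∧
      ¬ ComputablePred fun k : ℕ => (TM0.eval M (a :: List.replicate k b)).Dom := by
  obtain ⟨c, hc⟩ := exists_code_halting_two_pow
  let _ : Fintype PartrecToTM2.K' := ⟨{.main, .rev, .aux, .stack}, fun x => by cases x <;> simp⟩
  let _ : Inhabited PartrecToTM2.Λ' := ⟨PartrecToTM2.trNormal c PartrecToTM2.Cont'.halt⟩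
  have hs := PartrecToTM2.tr_supports c PartrecToTM2.Cont'.halt
  refine ⟨_, _, inferInstance, inferInstance, inferInstance,
    TM1to0.tr (TM2to1.tr PartrecToTM2.tr), _,
    (true, Function.update (fun _ => none) PartrecToTM2.K'.main (some PartrecToTM2.Γ'.cons)),
    (false, Function.update (fun _ => none) PartrecToTM2.K'.main (some PartrecToTM2.Γ'.bit1)),
    TM1to0.tr_supports _ (TM2to1.tr_supports _ hs), fun h => hc (h.of_eq fun k => ?_)⟩
  rw [TM1to0.tr_eval]
  have := TM2to1.tr_eval_dom PartrecToTM2.tr PartrecToTM2.K'.main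
    (PartrecToTM2.trList [2 ^ k - 1])
  have e : TM2to1.trInit (Γ := fun _ => PartrecToTM2.Γ') PartrecToTM2.K'.main
      (PartrecToTM2.trList [2 ^ k - 1]) =
    (true, Function.update (fun _ => none) PartrecToTM2.K'.main (some PartrecToTM2.Γ'.cons)) ::
      List.replicate k (false, Function.update (fun _ => none) PartrecToTM2.K'.main
        (some PartrecToTM2.Γ'.bit1)) := by
    simp [TM2to1.trInit, PartrecToTM2.trList, PartrecToTM2.trNat_two_pow_sub_one]
    exact congrArg _ List.map_replicate
  rw [e] at this
  refine this.trans ?_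
  have h2 := PartrecToTM2.tr_eval c [2 ^ k - 1]
  have e2 : TM2.init PartrecToTM2.K'.main (PartrecToTM2.trList [2 ^ k - 1])
      = PartrecToTM2.init c [2 ^ k - 1] := by
    simp only [TM2.init, PartrecToTM2.init]
    congr 1
    funext x
    cases x <;> rfl
  change (StateTransition.eval (TM2.step PartrecToTM2.tr)
    (TM2.init PartrecToTM2.K'.main (PartrecToTM2.trList [2 ^ k - 1]))).Dom ↔ _
  rw [e2, h2]
  rfl

/-- The contents of two stacks over `Bool`, tops first. -/
abbrev StackConfig := List Bool × List Bool

/-- One application of a rule of the rewriting system `R`, to the tops of the two stacks. -/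
def StackRewrites (R : List (StackConfig × StackConfig)) (c c' : StackConfig) : Prop :=
  ∃ ρ ∈ R, ∃ l r, c = (ρ.1.1 ++ l, ρ.1.2 ++ r) ∧ c' = (ρ.2.1 ++ l, ρ.2.2 ++ r)

/-- A rewriting sequence starting at `c` reaches a configuration to which no rule applies. -/
def StackHalts (R : List (StackConfig × StackConfig)) (c : StackConfig) : Prop :=
  ∃ c', Relation.ReflTransGen (StackRewrites R) c c' ∧ ∀ z, ¬ StackRewrites R c' z

section TapeRules

variable {Γ Λ : Type} [Inhabited Γ] [Inhabited Λ]

/-- Letters describing a tape: tape symbols, an end marker, and a state paired with the symbol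
under the head. -/
abbrev TapeLetter (Γ : Type) {Λ : Type} (S : Finset Λ) := Option Γ ⊕ (S × Γ)

/-- The rewriting rules simulating a Post-Turing machine, with the tops of the stacks first. -/
inductive TapeRule (M : TM0.Machine Γ Λ) (S : Finset Λ) :
    List (TapeLetter Γ S) × List (TapeLetter Γ S) →
      List (TapeLetter Γ S) × List (TapeLetter Γ S) → Prop
  | write {q q' : S} {h a : Γ} : M q.1 h = some (q'.1, TM0.Stmt.write a) →
      TapeRule M S ([], [.inr (q, h)]) ([], [.inr (q', a)])
  | right {q q' : S} {h : Γ} (b : Γ) : M q.1 h = some (q'.1, TM0.Stmt.move Dir.right) →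
      TapeRule M S ([], [.inr (q, h), .inl (some b)]) ([.inl (some h)], [.inr (q', b)])
  | rightEnd {q q' : S} {h : Γ} : M q.1 h = some (q'.1, TM0.Stmt.move Dir.right) →
      TapeRule M S ([], [.inr (q, h), .inl none])
        ([.inl (some h)], [.inr (q', default), .inl none])
  | left {q q' : S} {h : Γ} (b : Γ) : M q.1 h = some (q'.1, TM0.Stmt.move Dir.left) →
      TapeRule M S ([.inl (some b)], [.inr (q, h)]) ([], [.inr (q', b), .inl (some h)])
  | leftEnd {q q' : S} {h : Γ} : M q.1 h = some (q'.1, TM0.Stmt.move Dir.left) →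
      TapeRule M S ([.inl none], [.inr (q, h)])
        ([.inl none], [.inr (q', default), .inl (some h)])

theorem TapeRule.finite [Finite Γ] (M : TM0.Machine Γ Λ) (S : Finset Λ) :
    {ρ : _ × _ | TapeRule M S ρ.1 ρ.2}.Finite := by
  have h := List.finite_length_le (TapeLetter Γ S) 2
  refine ((h.prod h).prod (h.prod h)).subset ?_
  rintro ⟨_, _⟩ (_ | _ | _ | _ | _) <;> simp

/-- One-hot encoding of a finite alphabet by words of equal length. -/
theorem exists_blockCode (A : Type) [Finite A] :
    ∃ (m : ℕ) (code : A → List Bool), (∀ a, (code a).length = m) ∧ Function.Injective code := by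
  obtain ⟨m, ⟨e⟩⟩ := Finite.exists_equiv_fin A
  refine ⟨m, fun a => List.ofFn fun j => decide (j = e a), by simp, fun a b h => ?_⟩
  have := congrFun (List.ofFn_injective h) (e a)
  simpa using this

theorem exists_stackRewriting_of_postTuringMachine [Finite Γ] (M : TM0.Machine Γ Λ)
    (S : Finset Λ) (hS : TM0.Supports M (S : Set Λ)) (a b : Γ) :
    ∃ (R : List (StackConfig × StackConfig)) (s t w u : List Bool),
      (∀ c c₁ c₂, StackRewrites R c c₁ → StackRewrites R c c₂ → c₁ = c₂) ∧
      (∀ ρ ∈ R, ρ.1.1.length + ρ.1.2.length ≤ ρ.2.1.length + ρ.2.2.length) ∧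
      ∀ k, StackHalts R (s, t ++ ((List.replicate k w).flatten ++ u)) ↔
        (TM0.eval M (a :: List.replicate k b)).Dom := by
  classical
  obtain ⟨m, code, hlen, hinj⟩ := exists_blockCode (TapeLetter Γ S)
  have hcode : ∀ x y u v, code x ++ u = code y ++ v ↔ x = y ∧ u = v := fun x y u v =>
    ⟨fun h => by
      obtain ⟨h1, h2⟩ := List.append_inj h (by simp [hlen])
      exact ⟨hinj h1, h2⟩, by rintro ⟨rfl, rfl⟩; rfl⟩
  set R : List (StackConfig × StackConfig) := (TapeRule.finite M S).toFinset.toList.map fun ρ =>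
    ((ρ.1.1.flatMap code, ρ.1.2.flatMap code), (ρ.2.1.flatMap code, ρ.2.2.flatMap code)) with hR
  have hstep : ∀ c c', StackRewrites R c c' ↔ ∃ g h, TapeRule M S g h ∧ ∃ l r,
      c = (g.1.flatMap code ++ l, g.2.flatMap code ++ r) ∧
      c' = (h.1.flatMap code ++ l, h.2.flatMap code ++ r) := by
    intro c c'
    simp only [StackRewrites, hR, List.mem_map, Finset.mem_toList, Set.Finite.mem_toFinset]
    constructor
    · rintro ⟨_, ⟨ρ, hρ, rfl⟩, l, r, h1, h2⟩
      exact ⟨ρ.1, ρ.2, hρ, l, r, h1, h2⟩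
    · rintro ⟨g, h, hgh, l, r, h1, h2⟩
      exact ⟨_, ⟨(g, h), hgh, rfl⟩, l, r, h1, h2⟩
  have hdet : ∀ c c₁ c₂, StackRewrites R c c₁ → StackRewrites R c c₂ → c₁ = c₂ := by
    intro c c₁ c₂ h₁ h₂
    obtain ⟨g, h, hgh, l, r, rfl, rfl⟩ := (hstep _ _).1 h₁
    obtain ⟨g', h', hgh', l', r', e, rfl⟩ := (hstep _ _).1 h₂
    cases hgh <;> cases hgh' <;>
      simp only [List.flatMap_cons, List.flatMap_nil, List.append_nil, List.nil_append,
        List.append_assoc, Prod.mk.injEq, hcode, Sum.inr.injEq, Sum.inl.injEq, reduceCtorEq,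
        Option.some.injEq, false_and, and_false, true_and] at e <;> grind
  refine ⟨R, code (.inl none), code (.inr (⟨default, hS.1⟩, a)), code (.inl (some b)),
    code (.inl none), hdet, ?_, fun k => ?_⟩
  · simp only [hR, List.mem_map, Finset.mem_toList, Set.Finite.mem_toFinset]
    rintro _ ⟨⟨g, h⟩, hgh, rfl⟩
    have hgh' : TapeRule M S g h := hgh
    cases hgh' <;> simp [hlen]
  set f : StackConfig → Option StackConfig := fun c =>
    if h : ∃ c', StackRewrites R c c' then some h.choose else none with hf
  have hf_some : ∀ c c', c' ∈ f c ↔ StackRewrites R c c' := by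
    intro c c'
    by_cases h : ∃ c', StackRewrites R c c'
    · simp only [hf, dif_pos h, Option.mem_some_iff]
      exact ⟨fun e => e ▸ h.choose_spec, fun h' => hdet _ _ _ h.choose_spec h'⟩
    · simp only [hf, dif_neg h, Option.mem_def, reduceCtorEq, false_iff]
      exact fun h' => h ⟨_, h'⟩
  have hf_none : ∀ c, f c = none ↔ ∀ c', ¬ StackRewrites R c c' := fun c => by
    simp only [Option.eq_none_iff_forall_not_mem, hf_some]
  set tr : TM0.Cfg Γ Λ → StackConfig → Prop := fun c d =>
    ∃ (hq : c.q ∈ S) (l r : List Γ), c.Tape.left = ListBlank.mk l ∧ c.Tape.right = ListBlank.mk r ∧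
      d = ((l.map fun x => code (.inl (some x))).flatten ++ code (.inl none),
        code (.inr (⟨c.q, hq⟩, c.Tape.head)) ++
          ((r.map fun x => code (.inl (some x))).flatten ++ code (.inl none))) with htr
  have hresp : StateTransition.Respects (TM0.step M) f tr := by
    rintro ⟨q, ⟨h, L, Rt⟩⟩ d ⟨hq, l, r, hl, hr, rfl⟩
    simp only at hq hl hr
    subst hl hr
    set ends : List Γ → List Bool := fun l =>
      (l.map fun x => code (.inl (some x))).flatten ++ code (.inl none)
    have hsingle : ∀ {c d d'}, tr c d' → StackRewrites R d d' →
        ∃ e, tr c e ∧ StateTransition.Reaches₁ f d e := fun h₁ h₂ =>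
      ⟨_, h₁, Relation.TransGen.single ((hf_some _ _).2 h₂)⟩
    cases hM : M q h with
    | none =>
      have hs : TM0.step M ⟨q, ⟨h, ListBlank.mk l, ListBlank.mk r⟩⟩ = none := by
        simp [TM0.step, hM]
      simp only [hs, hf_none]
      intro c' hc'
      obtain ⟨g, g', hgg, l', r', e, -⟩ := (hstep _ _).1 hc'
      cases hgg <;>
        simp only [List.flatMap_cons, List.flatMap_nil, List.append_nil, List.nil_append,
          List.append_assoc, Prod.mk.injEq, hcode, Sum.inr.injEq] at e <;> grind
    | some p =>
      obtain ⟨q', st⟩ := p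
      have hq' : q' ∈ S := hS.2 (show (q', st) ∈ M q h from hM) hq
      cases st with
      | write a' =>
        have hs : TM0.step M ⟨q, ⟨h, ListBlank.mk l, ListBlank.mk r⟩⟩ =
            some ⟨q', ⟨a', ListBlank.mk l, ListBlank.mk r⟩⟩ := by
          simp [TM0.step, hM, Tape.write]
        simp only [hs]
        refine hsingle ⟨hq', l, r, rfl, rfl, rfl⟩ ((hstep _ _).2
          ⟨_, _, .write (q := ⟨q, hq⟩) (q' := ⟨q', hq'⟩) hM, ends l, ends r,
            by simp [ends], by simp [ends]⟩)
      | move dir =>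
        cases dir with
        | left =>
          have hs : TM0.step M ⟨q, ⟨h, ListBlank.mk l, ListBlank.mk r⟩⟩ =
              some ⟨q', ⟨(ListBlank.mk l).head, (ListBlank.mk l).tail,
                (ListBlank.mk r).cons h⟩⟩ := by
            simp [TM0.step, hM, Tape.move]
          simp only [hs]
          cases l with
          | nil =>
            refine hsingle ⟨hq', [], h :: r, rfl, rfl, rfl⟩ ((hstep _ _).2
              ⟨_, _, .leftEnd (q := ⟨q, hq⟩) (q' := ⟨q', hq'⟩) hM, [], ends r,
                by simp [ends], by simp [ends]⟩)
          | cons b' l =>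
            refine hsingle ⟨hq', l, h :: r, rfl, rfl, rfl⟩ ((hstep _ _).2
              ⟨_, _, .left (q := ⟨q, hq⟩) (q' := ⟨q', hq'⟩) b' hM, ends l, ends r,
                by simp [ends], by simp [ends]⟩)
        | right =>
          have hs : TM0.step M ⟨q, ⟨h, ListBlank.mk l, ListBlank.mk r⟩⟩ =
              some ⟨q', ⟨(ListBlank.mk r).head, (ListBlank.mk l).cons h,
                (ListBlank.mk r).tail⟩⟩ := by
            simp [TM0.step, hM, Tape.move]
          simp only [hs]
          cases r with
          | nil =>
            refine hsingle ⟨hq', h :: l, [], rfl, rfl, rfl⟩ ((hstep _ _).2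
              ⟨_, _, .rightEnd (q := ⟨q, hq⟩) (q' := ⟨q', hq'⟩) hM, ends l, [],
                by simp [ends], by simp [ends]⟩)
          | cons b' r =>
            refine hsingle ⟨hq', h :: l, r, rfl, rfl, rfl⟩ ((hstep _ _).2
              ⟨_, _, .right (q := ⟨q, hq⟩) (q' := ⟨q', hq'⟩) b' hM, ends l, ends r,
                by simp [ends], by simp [ends]⟩)
  have hinit : tr (TM0.init (a :: List.replicate k b)) (code (.inl none),
      code (.inr (⟨default, hS.1⟩, a)) ++
        ((List.replicate k (code (.inl (some b)))).flatten ++ code (.inl none))) := by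
    refine ⟨hS.1, [], List.replicate k b, rfl, rfl, ?_⟩
    simp only [List.map_nil, List.flatten_nil, List.nil_append, List.map_replicate]
    rfl
  have := StateTransition.tr_eval_dom hresp hinit
  change _ ↔ (StateTransition.eval (TM0.step M) (TM0.init (a :: List.replicate k b))).Dom
  rw [← this, Part.dom_iff_mem]
  simp only [StateTransition.mem_eval, StackHalts, StateTransition.Reaches, hf_none, hf_some]

end TapeRules

section OperatorModel

open Module

variable {V : Type*} [AddCommGroup V] [Module ℂ V]

/-- The operator pushing the words of `c` onto the two stacks. -/
def wordOp (push : Bool → Bool → End ℂ V) (c : StackConfig) : End ℂ V :=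
  (c.1.map (push false)).prod * (c.2.map (push true)).prod

/-- Relations between operators that on a nonzero finite-dimensional space force the rewriting
system `R` to halt on `c`. -/
structure IsHaltingModel (R : List (StackConfig × StackConfig)) (c : StackConfig)
    (push : Bool → Bool → End ℂ V) (S C X P : End ℂ V) : Prop where
  push_comm : ∀ a b, push false a * push true b = push true b * push false a
  step_word : ∀ ρ ∈ R, S * wordOp push ρ.1 = wordOp push ρ.2
  lower_comm : C * X = (X + 1) * C
  ker_lower_le : LinearMap.ker C ≤ LinearMap.ker P
  ker_lower_le_range : LinearMap.ker C ≤ LinearMap.range (wordOp push c)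
  map_step_le : (LinearMap.ker P).map S ≤ LinearMap.ker P
  map_step_disjoint : (LinearMap.ker P).map S ⊓ LinearMap.ker C ≤ ⊥
  step_injective : LinearMap.ker P ⊓
    ((R.map fun ρ => LinearMap.range (wordOp push ρ.1)).foldr (· ⊔ ·) ⊥) ⊓ LinearMap.ker S ≤ ⊥

theorem mem_foldr_sup {ι : Type*} {f : ι → Submodule ℂ V} {l : List ι} {i : ι} (hi : i ∈ l) :
    f i ≤ (l.map f).foldr (· ⊔ ·) ⊥ := by
  induction l with
  | nil => simp at hi
  | cons j l ih =>
    rcases List.mem_cons.1 hi with rfl | hi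
    · exact le_sup_left
    · exact (ih hi).trans le_sup_right

theorem foldr_sup_le {ι : Type*} {f : ι → Submodule ℂ V} {l : List ι} {W : Submodule ℂ V}
    (h : ∀ i ∈ l, f i ≤ W) : (l.map f).foldr (· ⊔ ·) ⊥ ≤ W := by
  induction l with
  | nil => simp
  | cons j l ih =>
    exact sup_le (h _ List.mem_cons_self) (ih fun i hi => h i (List.mem_cons_of_mem _ hi))

theorem wordOp_append {push : Bool → Bool → End ℂ V}
    (h : ∀ a b, push false a * push true b = push true b * push false a) (c : StackConfig)
    (l r : List Bool) :
    wordOp push (c.1 ++ l, c.2 ++ r) = wordOp push c * wordOp push (l, r) := by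
  have hc : Commute (l.map (push false)).prod (c.2.map (push true)).prod := by
    refine Commute.list_prod_left _ _ fun x hx => Commute.list_prod_right _ _ fun y hy => ?_
    obtain ⟨a, -, rfl⟩ := List.mem_map.1 hx
    obtain ⟨b, -, rfl⟩ := List.mem_map.1 hy
    exact h a b
  simp only [wordOp, List.map_append, List.prod_append]
  rw [mul_assoc, mul_assoc, ← mul_assoc (c.2.map _).prod, ← hc.eq]
  simp only [mul_assoc]

theorem IsHaltingModel.stackHalts [FiniteDimensional ℂ V] [Nontrivial V]
    {R : List (StackConfig × StackConfig)} {c : StackConfig} {push : Bool → Bool → End ℂ V}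
    {S C X P : End ℂ V} (h : IsHaltingModel R c push S C X P) : StackHalts R c := by
  have hker : LinearMap.ker C ≠ ⊥ := by
    intro hC
    have hinj : Function.Injective C := LinearMap.ker_eq_bot.1 hC
    have hsurj := LinearMap.injective_iff_surjective.1 hinj
    let e := LinearEquiv.ofBijective C ⟨hinj, hsurj⟩
    have hX : e.conj X = X + 1 := by
      ext v
      obtain ⟨w, rfl⟩ := hsurj v
      have hw : e.symm (C w) = w := e.symm_apply_apply w
      rw [LinearEquiv.conj_apply_apply, hw]
      exact LinearMap.congr_fun h.lower_comm w
    have ht := LinearMap.trace_conj' X e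
    rw [hX, map_add, LinearMap.trace_one] at ht
    have : (finrank ℂ V : ℂ) = 0 := by simpa using ht
    exact finrank_pos.ne' (Nat.cast_eq_zero.1 this)
  obtain ⟨v₀, hv₀, hne⟩ := Submodule.exists_mem_ne_zero_of_ne_bot hker
  obtain ⟨e, rfl⟩ := h.ker_lower_le_range hv₀
  by_contra hhalt
  have hnext : ∀ c', Relation.ReflTransGen (StackRewrites R) c c' →
      ∃ z, StackRewrites R c' z := by
    intro c' hc'
    by_contra hno
    exact hhalt ⟨c', hc', fun z hz => hno ⟨z, hz⟩⟩
  have hstep : ∀ {c₁ c₂}, StackRewrites R c₁ c₂ → S (wordOp push c₁ e) = wordOp push c₂ e := by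
    rintro _ _ ⟨ρ, hρ, l, r, rfl, rfl⟩
    rw [wordOp_append h.push_comm, wordOp_append h.push_comm, ← h.step_word ρ hρ]
    rfl
  let K₀ : Submodule ℂ V := Submodule.span ℂ
    {v | ∃ c', Relation.ReflTransGen (StackRewrites R) c c' ∧ v = wordOp push c' e}
  have hK₀P : K₀ ≤ LinearMap.ker P := by
    refine Submodule.span_le.2 ?_
    rintro _ ⟨c', hc', rfl⟩
    induction hc' with
    | refl => exact h.ker_lower_le hv₀
    | tail _ hs ih => exact hstep hs ▸ h.map_step_le (Submodule.mem_map_of_mem ih)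
  have hK₀N : K₀ ≤ (R.map fun ρ => LinearMap.range (wordOp push ρ.1)).foldr (· ⊔ ·) ⊥ := by
    refine Submodule.span_le.2 ?_
    rintro _ ⟨c', hc', rfl⟩
    obtain ⟨_, ρ, hρ, l, r, rfl, -⟩ := hnext c' hc'
    rw [wordOp_append h.push_comm]
    exact mem_foldr_sup (f := fun ρ : StackConfig × StackConfig =>
      LinearMap.range (wordOp push ρ.1)) hρ ⟨_, rfl⟩
  have hmap : K₀.map S ≤ K₀ := by
    refine Submodule.map_le_iff_le_comap.2 (Submodule.span_le.2 ?_)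
    rintro _ ⟨c', hc', rfl⟩
    obtain ⟨z, hz⟩ := hnext c' hc'
    exact Submodule.subset_span ⟨z, hc'.tail hz, hstep hz⟩
  have hdisj : Disjoint K₀ (LinearMap.ker S) :=
    disjoint_iff_inf_le.2 (le_trans (inf_le_inf_right _ (le_inf hK₀P hK₀N)) h.step_injective)
  have hfin : finrank ℂ (K₀.map S) = finrank ℂ K₀ := by
    rw [← LinearMap.range_domRestrict]
    exact LinearMap.finrank_range_of_inj (LinearMap.injective_domRestrict_iff.2 hdisj)
  have heq := Submodule.eq_of_le_of_finrank_eq hmap hfin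
  have hmem : wordOp push c e ∈ K₀.map S := by
    rw [heq]
    exact Submodule.subset_span ⟨c, .refl, rfl⟩
  exact hne ((Submodule.mem_bot ℂ).1 (h.map_step_disjoint ⟨Submodule.map_mono hK₀P hmem, hv₀⟩))

/-- The configurations reached from a halting one, with the properties of a path. -/
theorem StackHalts.exists_orbit {R : List (StackConfig × StackConfig)} {c : StackConfig}
    (hdet : ∀ c c₁ c₂, StackRewrites R c c₁ → StackRewrites R c c₂ → c₁ = c₂)
    (h : StackHalts R c) :
    ∃ O : Finset StackConfig, c ∈ O ∧ (∀ x ∈ O, ∀ y, StackRewrites R x y → y ∈ O) ∧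
      (∀ x ∈ O, ∀ y ∈ O, ∀ z, StackRewrites R x z → StackRewrites R y z → x = y) ∧
      ∀ x ∈ O, ¬ StackRewrites R x c := by
  classical
  obtain ⟨d, hcd, hd⟩ := h
  induction hcd using Relation.ReflTransGen.head_induction_on with
  | refl => exact ⟨{d}, by simp, by simp +contextual [hd], by simp, by simp [hd]⟩
  | @head c c₁ hs _ ih =>
    obtain ⟨O, hmem, hcl, hinj, hno⟩ := ih
    have hc : c ∉ O := fun hc => hno c hc hs
    refine ⟨insert c O, by simp, ?_, ?_, ?_⟩
    · intro x hx y hxy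
      rcases Finset.mem_insert.1 hx with rfl | hx
      · exact Finset.mem_insert_of_mem (hdet _ _ _ hs hxy ▸ hmem)
      · exact Finset.mem_insert_of_mem (hcl x hx y hxy)
    · intro x hx y hy z hxz hyz
      rcases Finset.mem_insert.1 hx with hx | hx <;> rcases Finset.mem_insert.1 hy with hy | hy
      · rw [hx, hy]
      · exact absurd (hdet _ _ _ hs (hx ▸ hxz) ▸ hyz) (hno y hy)
      · exact absurd (hdet _ _ _ hs (hy ▸ hyz) ▸ hxz) (hno x hx)
      · exact hinj x hx y hy z hxz hyz
    · intro x hx hxc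
      rcases Finset.mem_insert.1 hx with rfl | hx
      · exact hc (hdet _ _ _ hs hxc ▸ hmem)
      · exact hc (hcl x hx c hxc)

/-- Configurations whose total stack height is at most `n`. -/
abbrev BoundedConfig (n : ℕ) := {c : StackConfig // c.1.length + c.2.length ≤ n}

instance (n : ℕ) : Finite (BoundedConfig n) := by
  have h := List.finite_length_le Bool n
  refine ((h.prod h).subset ?_).to_subtype
  intro c (hc : c.1.length + c.2.length ≤ n)
  exact ⟨by simp; omega, by simp; omega⟩

open Classical in
/-- The basis vector of a configuration, zero when the stacks overflow. -/
noncomputable def ket (n : ℕ) (c : StackConfig) : BoundedConfig n →₀ ℂ :=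
  if h : c.1.length + c.2.length ≤ n then Finsupp.single ⟨c, h⟩ 1 else 0

theorem ket_of_le {n : ℕ} (c : BoundedConfig n) : ket n c.1 = Finsupp.single c 1 := dif_pos c.2

theorem ket_of_lt {n : ℕ} {c : StackConfig} (h : n < c.1.length + c.2.length) : ket n c = 0 :=
  dif_neg h.not_ge

/-- The operator with prescribed values on the basis vectors. -/
noncomputable def ketOp {n : ℕ} (σ : StackConfig → BoundedConfig n →₀ ℂ) :
    End ℂ (BoundedConfig n →₀ ℂ) :=
  Finsupp.linearCombination ℂ fun c => σ c.1

theorem ketOp_ket {n : ℕ} (σ : StackConfig → BoundedConfig n →₀ ℂ) {c : StackConfig}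
    (h : c.1.length + c.2.length ≤ n) : ketOp σ (ket n c) = σ c := by
  rw [ket_of_le ⟨c, h⟩, ketOp, Finsupp.linearCombination_single, one_smul]

theorem ext_ket {n : ℕ} {W : Type*} [AddCommGroup W] [Module ℂ W]
    {f g : (BoundedConfig n →₀ ℂ) →ₗ[ℂ] W}
    (h : ∀ c : StackConfig, c.1.length + c.2.length ≤ n → f (ket n c) = g (ket n c)) : f = g := by
  refine Finsupp.lhom_ext' fun c => LinearMap.ext_ring ?_
  simpa [ket_of_le] using h c.1 c.2

/-- A lowering operator with one-dimensional kernel, together with a grading. -/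
theorem exists_lowering {B : Type*} [Finite B] (b₀ : B) :
    ∃ C X : End ℂ (B →₀ ℂ), C * X = (X + 1) * C ∧
      LinearMap.ker C = Submodule.span ℂ {Finsupp.single b₀ 1} := by
  classical
  obtain ⟨m, ⟨e₀⟩⟩ := Finite.exists_equiv_fin B
  have hm : 0 < m := (Fin.pos (e₀ b₀))
  let e : B ≃ Fin m := e₀.trans (Equiv.swap (e₀ b₀) ⟨0, hm⟩)
  have he : (e b₀ : ℕ) = 0 := by simp [e]
  let idx : B → ℕ := fun b => e b
  let unidx : ℕ → B := fun i => if h : i < m then e.symm ⟨i, h⟩ else b₀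
  have hunidx : ∀ b, unidx (idx b) = b := fun b => by simp [unidx, idx]
  have hidx : ∀ b i, i < idx b → idx (unidx i) = i := fun b i hi => by
    have : i < m := hi.trans (e b).2
    simp [unidx, idx, this]
  let X : End ℂ (B →₀ ℂ) := Finsupp.linearCombination ℂ fun b => (idx b : ℂ) • .single b 1
  let C : End ℂ (B →₀ ℂ) := Finsupp.linearCombination ℂ fun b =>
    if idx b = 0 then 0 else .single (unidx (idx b - 1)) 1
  let D : End ℂ (B →₀ ℂ) := Finsupp.linearCombination ℂ fun b => .single (unidx (idx b + 1)) 1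
  have hX : ∀ b, X (.single b 1) = (idx b : ℂ) • .single b 1 := fun b => by
    simp only [X, Finsupp.linearCombination_single, one_smul]
  have hC : ∀ b, C (.single b 1) = if idx b = 0 then 0 else .single (unidx (idx b - 1)) 1 :=
    fun b => by simp only [C, Finsupp.linearCombination_single, one_smul]
  have hD : ∀ b, D (.single b 1) = .single (unidx (idx b + 1)) 1 := fun b => by
    simp only [D, Finsupp.linearCombination_single, one_smul]
  refine ⟨C, X, ?_, le_antisymm ?_ ?_⟩
  · refine Finsupp.lhom_ext' fun b => LinearMap.ext_ring ?_
    simp only [LinearMap.comp_apply, Finsupp.lsingle_apply, Module.End.mul_apply, hX, map_smul,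
      hC, LinearMap.add_apply, Module.End.one_apply]
    by_cases hb : idx b = 0
    · simp [hb]
    · obtain ⟨i, hi⟩ := Nat.exists_eq_succ_of_ne_zero hb
      rw [if_neg hb, hX, hidx b _ (by omega), hi, Nat.succ_sub_one, Nat.succ_eq_add_one]
      push_cast
      rw [add_smul, one_smul]
  · intro v hv
    have hproj : ∀ v, v - D (C v) ∈ Submodule.span ℂ {Finsupp.single b₀ (1 : ℂ)} := by
      intro v
      induction v using Finsupp.induction_linear with
      | zero => simp
      | add v w hv hw =>
        rw [map_add, map_add, add_sub_add_comm]
        exact add_mem hv hw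
      | single b a =>
        rw [← mul_one a, ← smul_eq_mul, ← Finsupp.smul_single, map_smul, map_smul, ← smul_sub]
        refine Submodule.smul_mem _ _ ?_
        rw [hC]
        split_ifs with hb
        · have : b = b₀ := by rw [← hunidx b, hb, ← he]; exact hunidx b₀
          rw [map_zero, sub_zero, this]
          exact Submodule.mem_span_singleton_self _
        · rw [hD, hidx b _ (by omega), Nat.sub_add_cancel (by omega), hunidx, sub_self]
          exact zero_mem _
    have := hproj v
    rwa [LinearMap.mem_ker.1 hv, map_zero, sub_zero] at this
  · rw [Submodule.span_singleton_le_iff_mem, LinearMap.mem_ker, hC, if_pos he]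

open Classical in
theorem StackHalts.exists_isHaltingModel {R : List (StackConfig × StackConfig)} {c : StackConfig}
    (hdet : ∀ c c₁ c₂, StackRewrites R c c₁ → StackRewrites R c c₂ → c₁ = c₂)
    (hlen : ∀ ρ ∈ R, ρ.1.1.length + ρ.1.2.length ≤ ρ.2.1.length + ρ.2.2.length)
    (h : StackHalts R c) :
    ∃ (n : ℕ) (push : Bool → Bool → End ℂ (BoundedConfig n →₀ ℂ))
      (S C X P : End ℂ (BoundedConfig n →₀ ℂ)), IsHaltingModel R c push S C X P := by
  obtain ⟨O, hcO, hcl, hinj, hno⟩ := h.exists_orbit hdet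
  let n := O.sup fun c => c.1.length + c.2.length
  have hOn : ∀ x ∈ O, x.1.length + x.2.length ≤ n := fun x hx =>
    Finset.le_sup (f := fun c : StackConfig => c.1.length + c.2.length) hx
  have hmono : ∀ {x y}, StackRewrites R x y →
      x.1.length + x.2.length ≤ y.1.length + y.2.length := by
    rintro _ _ ⟨ρ, hρ, l, r, rfl, rfl⟩
    have := hlen ρ hρ
    simp only [List.length_append]
    omega
  let push : Bool → Bool → End ℂ (BoundedConfig n →₀ ℂ) := fun a b => ketOp fun c =>
    ket n (bif a then (c.1, b :: c.2) else (b :: c.1, c.2))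
  let S : End ℂ (BoundedConfig n →₀ ℂ) := ketOp fun c =>
    if h : ∃ c', StackRewrites R c c' then ket n h.choose else 0
  let P : End ℂ (BoundedConfig n →₀ ℂ) := ketOp fun c => if c ∈ O then 0 else ket n c
  let E : End ℂ (BoundedConfig n →₀ ℂ) := ketOp fun c =>
    if ∃ c', StackRewrites R c c' then ket n c else 0
  let T : End ℂ (BoundedConfig n →₀ ℂ) := ketOp fun c =>
    if h : ∃ x, x ∈ O ∧ StackRewrites R x c then ket n h.choose else 0
  obtain ⟨C, X, hCX, hC⟩ := exists_lowering (B := BoundedConfig n) ⟨c, hOn c hcO⟩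
  have hpush : ∀ a b x, push a b (ket n x) =
      ket n (bif a then (x.1, b :: x.2) else (b :: x.1, x.2)) := by
    intro a b x
    by_cases hx : x.1.length + x.2.length ≤ n
    · exact ketOp_ket _ hx
    · rw [ket_of_lt (by omega), map_zero, ket_of_lt]
      cases a <;> simp <;> omega
  have hword : ∀ g x, wordOp push g (ket n x) = ket n (g.1 ++ x.1, g.2 ++ x.2) := by
    rintro ⟨g₁, g₂⟩ x
    have h₂ : (g₂.map (push true)).prod (ket n x) = ket n (x.1, g₂ ++ x.2) := by
      induction g₂ with
      | nil => simp
      | cons b g ih => simp [ih, hpush]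
    have h₁ : ∀ y, (g₁.map (push false)).prod (ket n y) = ket n (g₁ ++ y.1, y.2) := by
      intro y
      induction g₁ with
      | nil => simp
      | cons b g ih => simp [ih, hpush]
    rw [wordOp, Module.End.mul_apply, h₂, h₁]
  have hS : ∀ {x y}, StackRewrites R x y → S (ket n x) = ket n y := by
    intro x y hxy
    by_cases hx : x.1.length + x.2.length ≤ n
    · have he : ∃ y, StackRewrites R x y := ⟨y, hxy⟩
      rw [ketOp_ket _ hx, dif_pos he, hdet _ _ _ he.choose_spec hxy]
    · have := hmono hxy
      rw [ket_of_lt (by omega), map_zero, ket_of_lt (by omega)]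
  have hS' : ∀ {x}, (¬ ∃ y, StackRewrites R x y) → S (ket n x) = 0 := by
    intro x hx
    by_cases hxn : x.1.length + x.2.length ≤ n
    · rw [ketOp_ket _ hxn, dif_neg hx]
    · rw [ket_of_lt (by omega), map_zero]
  have hP : ∀ x ∈ O, P (ket n x) = 0 := fun x hx => by
    rw [ketOp_ket _ (hOn x hx), if_pos hx]
  have hP' : ∀ x ∉ O, x.1.length + x.2.length ≤ n → P (ket n x) = ket n x := fun x hx hxn => by
    rw [ketOp_ket _ hxn, if_neg hx]
  have hE : ∀ {x y}, StackRewrites R x y → E (ket n x) = ket n x := by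
    intro x y hxy
    by_cases hxn : x.1.length + x.2.length ≤ n
    · rw [ketOp_ket _ hxn, if_pos ⟨y, hxy⟩]
    · rw [ket_of_lt (by omega), map_zero]
  have hE' : ∀ {x}, (¬ ∃ y, StackRewrites R x y) → x.1.length + x.2.length ≤ n →
      E (ket n x) = 0 := fun hx hxn => by
    rw [ketOp_ket _ hxn, if_neg hx]
  have hT : ∀ {x y}, x ∈ O → StackRewrites R x y → T (ket n y) = ket n x := by
    intro x y hx hxy
    have he : ∃ x, x ∈ O ∧ StackRewrites R x y := ⟨x, hx, hxy⟩
    rw [ketOp_ket _ (hOn y (hcl x hx y hxy)), dif_pos he,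
      hinj _ he.choose_spec.1 _ hx _ he.choose_spec.2 hxy]
  have hker : ∀ v ∈ LinearMap.ker P, (1 - P) v = v := fun v hv => by
    rw [LinearMap.sub_apply, LinearMap.mem_ker.1 hv, sub_zero, Module.End.one_apply]
  have hcket : ket n c = Finsupp.single ⟨c, hOn c hcO⟩ 1 := ket_of_le (n := n) ⟨c, hOn c hcO⟩
  have hext : ∀ {W : Type} [AddCommGroup W] [Module ℂ W] {f g : (BoundedConfig n →₀ ℂ) →ₗ[ℂ] W},
      (∀ x ∈ O, f (ket n x) = g (ket n x)) → f ∘ₗ (1 - P) = g ∘ₗ (1 - P) := by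
    intro W _ _ f g hfg
    refine ext_ket fun x hx => ?_
    by_cases hxO : x ∈ O
    · simp [hP x hxO, hfg x hxO]
    · simp [hP' x hxO hx]
  rw [← hcket] at hC
  refine ⟨n, push, S, C, X, P, ?_, ?_, hCX, ?_, ?_, ?_, ?_, ?_⟩
  · intro a b
    refine ext_ket fun x hx => ?_
    simp [hpush]
  · intro ρ hρ
    refine ext_ket fun x hx => ?_
    rw [Module.End.mul_apply, hword, hword]
    exact hS ⟨ρ, hρ, x.1, x.2, rfl, rfl⟩
  · rw [hC, Submodule.span_singleton_le_iff_mem]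
    exact hP c hcO
  · rw [hC, Submodule.span_singleton_le_iff_mem]
    exact ⟨ket n ([], []), by simp [hword]⟩
  · rintro _ ⟨v, hv, rfl⟩
    rw [LinearMap.mem_ker, ← hker v hv]
    refine LinearMap.congr_fun (hext (f := P ∘ₗ S) (g := 0) fun x hx => ?_) v
    by_cases hxy : ∃ y, StackRewrites R x y
    · obtain ⟨y, hxy⟩ := hxy
      simp [hS hxy, hP y (hcl x hx y hxy)]
    · simp [hS' hxy]
  · rintro _ ⟨⟨v, hv, rfl⟩, hCv⟩
    have h0 : (S v) ⟨c, hOn c hcO⟩ = 0 := by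
      rw [← hker v hv]
      refine LinearMap.congr_fun (hext (f := Finsupp.lapply ⟨c, hOn c hcO⟩ ∘ₗ S) (g := 0)
        fun x hx => ?_) v
      by_cases hxy : ∃ y, StackRewrites R x y
      · obtain ⟨y, hxy⟩ := hxy
        have hy := hOn y (hcl x hx y hxy)
        have hyc : y ≠ c := by rintro rfl; exact hno x hx hxy
        simp [hS hxy, ket_of_le (n := n) ⟨y, hy⟩, hyc]
      · simp [hS' hxy]
    rw [hC] at hCv
    obtain ⟨a, ha⟩ := Submodule.mem_span_singleton.1 hCv
    rw [← ha, hcket] at h0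
    have ha0 : a = 0 := by simpa using h0
    rw [Submodule.mem_bot, ← ha, ha0, zero_smul]
  · rintro v ⟨⟨hv, hvN⟩, hSv⟩
    have hEv : E v = v := by
      have : ((R.map fun ρ => LinearMap.range (wordOp push ρ.1)).foldr (· ⊔ ·) ⊥) ≤
          LinearMap.ker (E - 1) := by
        refine foldr_sup_le ?_
        rintro ρ hρ _ ⟨v, rfl⟩
        refine LinearMap.congr_fun (f := (E - 1) * wordOp push ρ.1) (g := 0)
          (ext_ket fun x hx => ?_) v
        rw [Module.End.mul_apply, hword, LinearMap.sub_apply,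
          hE ⟨ρ, hρ, x.1, x.2, rfl, rfl⟩]
        simp
      exact sub_eq_zero.1 (this hvN)
    have hTS := LinearMap.congr_fun (hext (f := T ∘ₗ S) (g := E) fun x hx => by
      by_cases hxy : ∃ y, StackRewrites R x y
      · obtain ⟨y, hxy⟩ := hxy
        simp [hS hxy, hT hx hxy, hE hxy]
      · simp [hS' hxy, hE' hxy (hOn x hx)]) v
    simp only [LinearMap.comp_apply, hker v hv, LinearMap.mem_ker.1 hSv, map_zero, hEv] at hTS
    exact hTS.symm

end OperatorModel

/-- Four summands, a diagonal, and two graphs between pairs of summands, in any type. -/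
structure Frame (α : Type*) where
  /-- First summand. -/
  e₁ : α
  /-- Second summand. -/
  e₂ : α
  /-- Third summand. -/
  e₃ : α
  /-- Fourth summand. -/
  e₄ : α
  /-- The diagonal. -/
  diag : α
  /-- Graphs from the first two to the last two summands. -/
  graph : Bool → α

namespace Frame

section Polynomials

variable {α : Type*} [Max α] [Min α] (f : Frame α)

/-- The diagonal of the first two summands. -/
def diag₁₂ : α := (f.diag ⊔ f.e₃ ⊔ f.e₄) ⊓ (f.e₁ ⊔ f.e₂)

/-- The diagonal of the second and third summands. -/
def diag₂₃ : α := (f.diag ⊔ f.e₁ ⊔ f.e₄) ⊓ (f.e₂ ⊔ f.e₃)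

/-- The diagonal of the last two summands. -/
def diag₃₄ : α := (f.diag ⊔ f.e₁ ⊔ f.e₂) ⊓ (f.e₃ ⊔ f.e₄)

/-- The graphs, between the second and third summands, of the negatives of the operators read off
from the blocks of `f.graph k`. -/
def op (k : Bool) : Bool → Bool → α
  | false, false =>
    ((f.graph k ⊓ (f.e₁ ⊔ f.e₃ ⊔ f.e₄)) ⊔ f.e₄ ⊔ f.diag₁₂) ⊓ (f.e₂ ⊔ f.e₃)
  | false, true =>
    ((((f.graph k ⊓ (f.e₁ ⊔ f.e₃ ⊔ f.e₄)) ⊔ f.e₃) ⊓ (f.e₁ ⊔ f.e₄)) ⊔ f.diag₁₂ ⊔ f.diag₃₄) ⊓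
      (f.e₂ ⊔ f.e₃)
  | true, false =>
    ((f.graph k ⊓ (f.e₂ ⊔ f.e₃ ⊔ f.e₄)) ⊔ f.e₄) ⊓ (f.e₂ ⊔ f.e₃)
  | true, true =>
    ((((f.graph k ⊓ (f.e₂ ⊔ f.e₃ ⊔ f.e₄)) ⊔ f.e₃) ⊓ (f.e₂ ⊔ f.e₄)) ⊔ f.diag₃₄) ⊓
      (f.e₂ ⊔ f.e₃)

/-- Composition of a relation `ρ` between the first two summands with the operator given
by `F`. -/
def app (F ρ : α) : α :=
  (((((ρ ⊔ f.e₃) ⊓ (f.e₁ ⊔ F)) ⊔ f.e₂) ⊓ (f.e₁ ⊔ f.e₃)) ⊔ f.diag₂₃) ⊓ (f.e₁ ⊔ f.e₂)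

/-- Composition of a relation `ρ` with the operator given by `F` increased by the identity. -/
def appSucc (F ρ : α) : α :=
  (((((ρ ⊔ f.e₃) ⊓ (f.e₁ ⊔ F)) ⊔ f.diag₂₃) ⊓ (f.e₁ ⊔ f.e₃)) ⊔ f.diag₂₃) ⊓ (f.e₁ ⊔ f.e₂)

/-- Composition of a relation with a word operator. -/
def word (c : StackConfig) (ρ : α) : α :=
  (c.1.map (f.op false false)).foldr f.app ((c.2.map (f.op false true)).foldr f.app ρ)

/-- The kernel of the operator given by `F`. -/
def kernel (F : α) : α := F ⊓ f.e₂

variable [Bot α] [Top α]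

/-- Inequalities expressing that `f` is isomorphic to a standard frame, if the summands are
independent. -/
def frameConds : List (α × α) :=
  [(⊤, f.e₁ ⊔ f.e₂ ⊔ f.e₃ ⊔ f.e₄),
    (f.diag ⊓ (f.e₂ ⊔ f.e₃ ⊔ f.e₄), ⊥), (⊤, f.diag ⊔ (f.e₂ ⊔ f.e₃ ⊔ f.e₄)),
    (f.diag ⊓ (f.e₁ ⊔ f.e₃ ⊔ f.e₄), ⊥), (⊤, f.diag ⊔ (f.e₁ ⊔ f.e₃ ⊔ f.e₄)),
    (f.diag ⊓ (f.e₁ ⊔ f.e₂ ⊔ f.e₄), ⊥), (⊤, f.diag ⊔ (f.e₁ ⊔ f.e₂ ⊔ f.e₄)),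
    (f.diag ⊓ (f.e₁ ⊔ f.e₂ ⊔ f.e₃), ⊥), (⊤, f.diag ⊔ (f.e₁ ⊔ f.e₂ ⊔ f.e₃)),
    (f.graph false ⊓ (f.e₃ ⊔ f.e₄), ⊥), (⊤, f.graph false ⊔ (f.e₃ ⊔ f.e₄)),
    (f.graph true ⊓ (f.e₃ ⊔ f.e₄), ⊥), (⊤, f.graph true ⊔ (f.e₃ ⊔ f.e₄))]

/-- Commutation of the push operators of the two stacks. -/
def commCond (a b : Bool) : α × α :=
  (f.app (f.op false false a) (f.app (f.op false true b) f.diag₁₂),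
    f.app (f.op false true b) (f.app (f.op false false a) f.diag₁₂))

/-- The action of the step operator on the words of a rule. -/
def ruleCond (ρ : StackConfig × StackConfig) : α × α :=
  (f.app (f.op true false false) (f.word ρ.1 f.diag₁₂), f.word ρ.2 f.diag₁₂)

/-- The span of the configurations to which some rule applies. -/
def active (R : List (StackConfig × StackConfig)) : α :=
  (R.map fun ρ => f.word ρ.1 f.e₂).foldr (· ⊔ ·) ⊥

/-- Inequalities expressing the relations of a halting model that do not involve the initial
configuration. -/
def machineConds (R : List (StackConfig × StackConfig)) : List (α × α) :=
  [f.commCond false false, f.commCond false true, f.commCond true false, f.commCond true true] ++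
  R.map f.ruleCond ++
  [(f.app (f.op true false true) (f.app (f.op true true false) f.diag₁₂),
      f.appSucc (f.op true true false) (f.app (f.op true false true) f.diag₁₂)),
    (f.kernel (f.op true false true), f.kernel (f.op true true true)),
    (f.app (f.op true false false) (f.kernel (f.op true true true)),
      f.kernel (f.op true true true)),
    (f.app (f.op true false false) (f.kernel (f.op true true true)) ⊓
      f.kernel (f.op true false true), ⊥),
    (f.kernel (f.op true true true) ⊓ f.active R ⊓ f.kernel (f.op true false false), ⊥)]

/-- The inequality involving the initial configuration `c`. -/
def initCond (c : StackConfig) : α × α := (f.kernel (f.op true false true), f.word c f.e₂)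

end Polynomials

section Hom

variable {α β : Type*} [Max α] [Min α] [Bot α] [Top α] [Max β] [Min β] [Bot β] [Top β]

/-- Maps commuting with the bounded lattice operations, without any laws on these. -/
structure IsPolyHom (φ : α → β) : Prop where
  map_sup : ∀ a b, φ (a ⊔ b) = φ a ⊔ φ b
  map_inf : ∀ a b, φ (a ⊓ b) = φ a ⊓ φ b
  map_bot : φ ⊥ = ⊥
  map_top : φ ⊤ = ⊤

/-- The image of a frame. -/
def map (φ : α → β) (f : Frame α) : Frame β :=
  ⟨φ f.e₁, φ f.e₂, φ f.e₃, φ f.e₄, φ f.diag, fun k => φ (f.graph k)⟩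

variable {φ : α → β}

theorem map_diag₁₂ (h : IsPolyHom φ) (f : Frame α) : φ f.diag₁₂ = (f.map φ).diag₁₂ := by
  simp only [diag₁₂, map, h.map_sup, h.map_inf]

theorem map_diag₂₃ (h : IsPolyHom φ) (f : Frame α) : φ f.diag₂₃ = (f.map φ).diag₂₃ := by
  simp only [diag₂₃, map, h.map_sup, h.map_inf]

theorem map_diag₃₄ (h : IsPolyHom φ) (f : Frame α) : φ f.diag₃₄ = (f.map φ).diag₃₄ := by
  simp only [diag₃₄, map, h.map_sup, h.map_inf]

theorem map_op (h : IsPolyHom φ) (f : Frame α) (k a b : Bool) :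
    φ (f.op k a b) = (f.map φ).op k a b := by
  cases a <;> cases b <;>
    simp only [op, h.map_sup, h.map_inf, map_diag₁₂ h, map_diag₃₄ h] <;> rfl

theorem map_app (h : IsPolyHom φ) (f : Frame α) (F ρ : α) :
    φ (f.app F ρ) = (f.map φ).app (φ F) (φ ρ) := by
  simp only [app, h.map_sup, h.map_inf, map_diag₂₃ h]
  rfl

theorem map_appSucc (h : IsPolyHom φ) (f : Frame α) (F ρ : α) :
    φ (f.appSucc F ρ) = (f.map φ).appSucc (φ F) (φ ρ) := by
  simp only [appSucc, h.map_sup, h.map_inf, map_diag₂₃ h]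
  rfl

theorem map_word (h : IsPolyHom φ) (f : Frame α) (c : StackConfig) (ρ : α) :
    φ (f.word c ρ) = (f.map φ).word c (φ ρ) := by
  have hfold : ∀ (a : Bool) (l : List Bool) (ρ : α),
      φ ((l.map (f.op false a)).foldr f.app ρ) =
        (l.map ((f.map φ).op false a)).foldr (f.map φ).app (φ ρ) := by
    intro a l ρ
    induction l with
    | nil => rfl
    | cons b l ih => simp only [List.map_cons, List.foldr_cons, map_app h, map_op h, ih]
  rw [word, hfold, hfold, word]

theorem map_kernel (h : IsPolyHom φ) (f : Frame α) (F : α) :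
    φ (f.kernel F) = (f.map φ).kernel (φ F) :=
  h.map_inf _ _

theorem map_active (h : IsPolyHom φ) (f : Frame α) (R : List (StackConfig × StackConfig)) :
    φ (f.active R) = (f.map φ).active R := by
  induction R with
  | nil => exact h.map_bot
  | cons ρ R ih =>
    simp only [active, List.map_cons, List.foldr_cons, h.map_sup, map_word h] at ih ⊢
    rw [ih]
    rfl

theorem map_frameConds (h : IsPolyHom φ) (f : Frame α) :
    f.frameConds.map (Prod.map φ φ) = (f.map φ).frameConds := by
  simp only [frameConds, List.map_cons, List.map_nil, Prod.map_apply, h.map_sup, h.map_inf,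
    h.map_bot, h.map_top]
  rfl

theorem map_initCond (h : IsPolyHom φ) (f : Frame α) (c : StackConfig) :
    Prod.map φ φ (f.initCond c) = (f.map φ).initCond c := by
  simp only [initCond, Prod.map_apply, map_kernel h, map_op h, map_word h]
  rfl

theorem map_machineConds (h : IsPolyHom φ) (f : Frame α)
    (R : List (StackConfig × StackConfig)) :
    (f.machineConds R).map (Prod.map φ φ) = (f.map φ).machineConds R := by
  have hrule : Prod.map φ φ ∘ f.ruleCond = (f.map φ).ruleCond := by
    funext ρ
    simp only [Function.comp_apply, ruleCond, Prod.map_apply, map_app h, map_op h, map_word h,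
      map_diag₁₂ h]
  simp only [machineConds, commCond, List.map_append, List.map_map, hrule, List.map_cons,
    List.map_nil, Prod.map_apply, map_app h, map_appSucc h, map_op h, map_kernel h, map_active h,
    map_diag₁₂ h, h.map_inf, h.map_bot]

end Hom

end Frame

namespace Frame

section Standard

open Module LinearMap

variable {V : Type*} [AddCommGroup V] [Module ℂ V]

/-- The standard frame of `V ^ 4` encoding eight operators. -/
def standard (T : Bool → Bool → Bool → End ℂ V) : Frame (Submodule ℂ ((V × V) × (V × V))) where
  e₁ := range (inl ℂ (V × V) (V × V) ∘ₗ inl ℂ V V)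
  e₂ := range (inl ℂ (V × V) (V × V) ∘ₗ inr ℂ V V)
  e₃ := range (inr ℂ (V × V) (V × V) ∘ₗ inl ℂ V V)
  e₄ := range (inr ℂ (V × V) (V × V) ∘ₗ inr ℂ V V)
  diag := range (((id : V →ₗ[ℂ] V).prod id).prod ((id : V →ₗ[ℂ] V).prod id))
  graph k := LinearMap.graph
    (((T k false false).coprod (-T k true false)).prod ((-T k false true).coprod (T k true true)))

/-- The relation between the first two summands parametrized by a pair of maps. -/
def rel {U : Type*} [AddCommGroup U] [Module ℂ U] (g h : U →ₗ[ℂ] V) :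
    Submodule ℂ ((V × V) × (V × V)) :=
  range ((g.prod h).prod (0 : U →ₗ[ℂ] V × V))

theorem mem_sup_range {W U : Type*} [AddCommGroup W] [Module ℂ W] [AddCommGroup U] [Module ℂ U]
    {j : U →ₗ[ℂ] W} {A : Submodule ℂ W} {x : W} : x ∈ A ⊔ range j ↔ ∃ t, x + j t ∈ A := by
  rw [Submodule.mem_sup]
  constructor
  · rintro ⟨y, hy, _, ⟨t, rfl⟩, rfl⟩
    exact ⟨-t, by simpa using hy⟩
  · rintro ⟨t, ht⟩
    exact ⟨_, ht, _, ⟨-t, rfl⟩, by simp⟩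

variable {T : Bool → Bool → Bool → End ℂ V} {A : Submodule ℂ ((V × V) × (V × V))} {a b c d : V}

theorem mem_e₁ : ((a, b), (c, d)) ∈ (standard T).e₁ ↔ b = 0 ∧ c = 0 ∧ d = 0 := by
  simp [standard, Prod.ext_iff, eq_comm]

theorem mem_e₂ : ((a, b), (c, d)) ∈ (standard T).e₂ ↔ a = 0 ∧ c = 0 ∧ d = 0 := by
  simp [standard, Prod.ext_iff, eq_comm]

theorem mem_e₃ : ((a, b), (c, d)) ∈ (standard T).e₃ ↔ a = 0 ∧ b = 0 ∧ d = 0 := by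
  simp [standard, Prod.ext_iff, eq_comm, and_assoc]

theorem mem_e₄ : ((a, b), (c, d)) ∈ (standard T).e₄ ↔ a = 0 ∧ b = 0 ∧ c = 0 := by
  simp [standard, Prod.ext_iff, eq_comm, and_assoc]

theorem mem_diag : ((a, b), (c, d)) ∈ (standard T).diag ↔ a = b ∧ a = c ∧ a = d := by
  simp [standard, and_assoc]

theorem mem_graph {k : Bool} : ((a, b), (c, d)) ∈ (standard T).graph k ↔
    c = T k false false a - T k true false b ∧ d = T k true true b - T k false true a := by
  simp [standard, mem_graph_iff, sub_eq_add_neg, add_comm]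

theorem mem_sup_e₁ : ((a, b), (c, d)) ∈ A ⊔ (standard T).e₁ ↔ ∃ t, ((t, b), (c, d)) ∈ A := by
  refine mem_sup_range.trans ((Equiv.addLeft a).exists_congr fun t => ?_)
  simp

theorem mem_sup_e₂ : ((a, b), (c, d)) ∈ A ⊔ (standard T).e₂ ↔ ∃ t, ((a, t), (c, d)) ∈ A := by
  refine mem_sup_range.trans ((Equiv.addLeft b).exists_congr fun t => ?_)
  simp

theorem mem_sup_e₃ : ((a, b), (c, d)) ∈ A ⊔ (standard T).e₃ ↔ ∃ t, ((a, b), (t, d)) ∈ A := by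
  refine mem_sup_range.trans ((Equiv.addLeft c).exists_congr fun t => ?_)
  simp

theorem mem_sup_e₄ : ((a, b), (c, d)) ∈ A ⊔ (standard T).e₄ ↔ ∃ t, ((a, b), (c, t)) ∈ A := by
  refine mem_sup_range.trans ((Equiv.addLeft d).exists_congr fun t => ?_)
  simp

theorem diag₁₂_eq : (standard T).diag₁₂ =
    range (((id : V →ₗ[ℂ] V).prod id).prod (0 : V →ₗ[ℂ] V × V)) := by
  ext ⟨⟨a, b⟩, ⟨c, d⟩⟩
  simp [diag₁₂, mem_sup_e₃, mem_sup_e₄, mem_sup_e₂, mem_diag, mem_e₁, Prod.ext_iff]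
  grind

theorem diag₂₃_eq : (standard T).diag₂₃ =
    range (((0 : V →ₗ[ℂ] V).prod id).prod ((id : V →ₗ[ℂ] V).prod 0)) := by
  ext ⟨⟨a, b⟩, ⟨c, d⟩⟩
  simp [diag₂₃, mem_sup_e₁, mem_sup_e₃, mem_sup_e₄, mem_diag, mem_e₂, Prod.ext_iff]
  grind

theorem diag₃₄_eq : (standard T).diag₃₄ =
    range ((0 : V →ₗ[ℂ] V × V).prod ((id : V →ₗ[ℂ] V).prod id)) := by
  ext ⟨⟨a, b⟩, ⟨c, d⟩⟩
  simp [diag₃₄, mem_sup_e₁, mem_sup_e₂, mem_sup_e₄, mem_diag, mem_e₃, Prod.ext_iff]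
  grind

theorem diag₁₂_eq_rel : (standard T).diag₁₂ = rel id id := diag₁₂_eq

theorem mem_sup_diag₁₂ :
    ((a, b), (c, d)) ∈ A ⊔ (standard T).diag₁₂ ↔ ∃ t, ((a + t, b + t), (c, d)) ∈ A := by
  rw [diag₁₂_eq, mem_sup_range]
  simp

theorem mem_sup_diag₂₃ :
    ((a, b), (c, d)) ∈ A ⊔ (standard T).diag₂₃ ↔ ∃ t, ((a, b + t), (c + t, d)) ∈ A := by
  rw [diag₂₃_eq, mem_sup_range]
  simp

theorem mem_sup_diag₃₄ :
    ((a, b), (c, d)) ∈ A ⊔ (standard T).diag₃₄ ↔ ∃ t, ((a, b), (c + t, d + t)) ∈ A := by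
  rw [diag₃₄_eq, mem_sup_range]
  simp

theorem mem_op {k i j : Bool} : ((a, b), (c, d)) ∈ (standard T).op k i j ↔
    a = 0 ∧ c = -T k i j b ∧ d = 0 := by
  cases i <;> cases j <;>
    simp [op, mem_sup_e₃, mem_sup_e₄, mem_sup_diag₁₂, mem_sup_diag₃₄, mem_graph, mem_e₁, mem_e₂,
      add_eq_zero_iff_neg_eq]
  all_goals grind

theorem mem_e₁_sup : ((a, b), (c, d)) ∈ (standard T).e₁ ⊔ A ↔ ∃ t, ((t, b), (c, d)) ∈ A := by
  rw [sup_comm, mem_sup_e₁]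

section Rel

variable {U : Type*} [AddCommGroup U] [Module ℂ U] {g h : U →ₗ[ℂ] V}

theorem mem_rel : ((a, b), (c, d)) ∈ rel g h ↔ (∃ u, g u = a ∧ h u = b) ∧ c = 0 ∧ d = 0 := by
  simp [rel, Prod.ext_iff, eq_comm]

theorem app_rel (k i j : Bool) :
    (standard T).app ((standard T).op k i j) (rel g h) = rel g (T k i j ∘ₗ h) := by
  ext ⟨⟨a, b⟩, ⟨c, d⟩⟩
  simp only [app, Submodule.mem_inf, mem_sup_diag₂₃, mem_sup_e₂, mem_sup_e₃, mem_e₁_sup, mem_op,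
    mem_rel, mem_e₁, LinearMap.comp_apply]
  constructor
  · rintro ⟨⟨t, ⟨y, ⟨⟨_, ⟨u, rfl, rfl⟩, -, -⟩, _, -, h₁, -⟩⟩, _, h₃, h₂, -⟩, -, -, rfl, rfl⟩
    exact ⟨⟨u, rfl, by grind⟩, rfl, rfl⟩
  · rintro ⟨⟨u, rfl, rfl⟩, rfl, rfl⟩
    exact ⟨⟨-T k i j (h u), ⟨h u, ⟨0, ⟨u, rfl, rfl⟩, rfl, rfl⟩, 0, rfl, by simp, rfl⟩, by simp⟩,
      by simp⟩

theorem appSucc_rel (k i j : Bool) :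
    (standard T).appSucc ((standard T).op k i j) (rel g h) = rel g ((T k i j + 1) ∘ₗ h) := by
  ext ⟨⟨a, b⟩, ⟨c, d⟩⟩
  simp only [appSucc, Submodule.mem_inf, mem_sup_diag₂₃, mem_sup_e₂, mem_sup_e₃, mem_e₁_sup,
    mem_op, mem_rel, mem_e₁, LinearMap.comp_apply, LinearMap.add_apply, End.one_apply]
  constructor
  · rintro ⟨⟨t, ⟨y, ⟨⟨_, ⟨u, rfl, h₀⟩, -, -⟩, _, -, h₁, -⟩⟩, _, h₃, h₂, -⟩, -, -, rfl, rfl⟩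
    exact ⟨⟨u, rfl, by grind⟩, rfl, rfl⟩
  · rintro ⟨⟨u, rfl, rfl⟩, rfl, rfl⟩
    exact ⟨⟨-(T k i j (h u) + h u), ⟨h u, ⟨0, ⟨u, rfl, by simp⟩, rfl, rfl⟩, 0, rfl, by simp, rfl⟩,
      by simp⟩, by simp⟩

theorem word_rel (c : StackConfig) :
    (standard T).word c (rel g h) = rel g (wordOp (T false) c ∘ₗ h) := by
  have hfold : ∀ (a : Bool) (l : List Bool) (h : U →ₗ[ℂ] V),
      (l.map ((standard T).op false a)).foldr (standard T).app (rel g h) =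
        rel g ((l.map (T false a)).prod ∘ₗ h) := by
    intro a l h
    induction l with
    | nil => rfl
    | cons b l ih =>
      rw [List.map_cons, List.foldr_cons, ih, app_rel, List.map_cons, List.prod_cons]
      rfl
  rw [word, hfold, hfold]
  rfl

end Rel

theorem rel_id_le {A B : End ℂ V} : rel id A ≤ rel id B ↔ A = B := by
  refine ⟨fun h => LinearMap.ext fun v => ?_, fun h => h ▸ le_rfl⟩
  have hv := h (mem_rel.2 ⟨⟨v, rfl, rfl⟩, rfl, rfl⟩)
  obtain ⟨⟨u, hu, hv⟩, -⟩ := mem_rel.1 hv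
  rw [id_apply] at hu
  rw [← hv, hu, id_apply]

/-- A subspace of `V` placed in the second summand. -/
def emb (K : Submodule ℂ V) : Submodule ℂ ((V × V) × (V × V)) :=
  K.map (inl ℂ (V × V) (V × V) ∘ₗ inr ℂ V V)

theorem emb_injective :
    Function.Injective (inl ℂ (V × V) (V × V) ∘ₗ inr ℂ V V) := by
  intro a b h
  simpa using h

theorem emb_le_emb {K L : Submodule ℂ V} : emb K ≤ emb L ↔ K ≤ L :=
  Submodule.map_le_map_iff_of_injective emb_injective _ _

theorem emb_inf {K L : Submodule ℂ V} : emb (K ⊓ L) = emb K ⊓ emb L :=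
  Submodule.map_inf _ emb_injective

theorem emb_sup {K L : Submodule ℂ V} : emb (K ⊔ L) = emb K ⊔ emb L := Submodule.map_sup _ _ _

theorem emb_bot : emb (⊥ : Submodule ℂ V) = ⊥ := Submodule.map_bot _

theorem rel_zero {U : Type*} [AddCommGroup U] [Module ℂ U] (h : U →ₗ[ℂ] V) :
    rel 0 h = emb (range h) := by
  rw [emb, ← range_comp]
  rfl

theorem e₂_eq_rel : (standard T).e₂ = rel 0 id := rfl

theorem word_e₂ (c : StackConfig) :
    (standard T).word c (standard T).e₂ = emb (range (wordOp (T false) c)) := by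
  rw [e₂_eq_rel, word_rel, rel_zero, comp_id]

theorem kernel_op (k i j : Bool) :
    (standard T).kernel ((standard T).op k i j) = emb (ker (T k i j)) := by
  ext ⟨⟨a, b⟩, ⟨c, d⟩⟩
  simp only [kernel, Submodule.mem_inf, mem_op, mem_e₂, emb]
  simp [Prod.ext_iff]
  grind

theorem app_emb (k i j : Bool) (K : Submodule ℂ V) :
    (standard T).app ((standard T).op k i j) (emb K) = emb (K.map (T k i j)) := by
  have hK : emb K = rel 0 K.subtype := by rw [rel_zero, Submodule.range_subtype]
  rw [hK, app_rel, rel_zero, range_comp, Submodule.range_subtype]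

theorem active_eq (R : List (StackConfig × StackConfig)) : (standard T).active R =
    emb ((R.map fun ρ => range (wordOp (T false) ρ.1)).foldr (· ⊔ ·) ⊥) := by
  induction R with
  | nil => exact emb_bot.symm
  | cons ρ R ih =>
    simp only [active, List.map_cons, List.foldr_cons, emb_sup, word_e₂] at ih ⊢
    rw [ih]

theorem conds_standard (R : List (StackConfig × StackConfig)) (c : StackConfig) :
    ((∀ p ∈ (standard T).machineConds R, p.1 ≤ p.2) ∧
      ((standard T).initCond c).1 ≤ ((standard T).initCond c).2) ↔
    IsHaltingModel R c (T false) (T true false false) (T true false true) (T true true false)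
      (T true true true) := by
  simp only [machineConds, initCond, commCond, ruleCond, List.mem_append, List.mem_cons,
    List.mem_map, List.not_mem_nil, or_false, or_imp, forall_and, forall_eq, kernel_op, app_emb,
    word_e₂, active_eq, ← emb_inf, ← emb_bot, emb_le_emb, diag₁₂_eq_rel, word_rel, app_rel,
    appSucc_rel, rel_id_le, forall_exists_index, and_imp, forall_apply_eq_imp_iff₂, comp_id]
  constructor
  · rintro ⟨⟨⟨⟨h₁, h₂, h₃, h₄⟩, hR⟩, hC, hCP, hS, hSC, hi⟩, hc⟩
    exact ⟨by rintro (_ | _) (_ | _) <;> assumption, hR, hC, hCP, hc, hS, hSC, hi⟩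
  · rintro ⟨hcomm, hR, hC, hCP, hc, hS, hSC, hi⟩
    exact ⟨⟨⟨⟨hcomm _ _, hcomm _ _, hcomm _ _, hcomm _ _⟩, hR⟩, hC, hCP, hS, hSC, hi⟩, hc⟩

theorem frameConds_standard : ∀ p ∈ (standard T).frameConds, p.1 ≤ p.2 := by
  simp only [frameConds, List.mem_cons, List.not_mem_nil, or_false, forall_eq_or_imp, forall_eq]
  refine ⟨?_, ?_, ?_, ?_, ?_, ?_, ?_, ?_, ?_, ?_, ?_, ?_, ?_⟩
  all_goals
    rintro ⟨⟨a, b⟩, ⟨c, d⟩⟩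
    simp [mem_sup_e₁, mem_sup_e₂, mem_sup_e₃, mem_sup_e₄, mem_e₁, mem_e₂, mem_e₃, mem_diag,
      mem_graph, ← sup_assoc, Prod.ext_iff]
  all_goals grind

end Standard

end Frame

namespace Frame

section Coordinatization

open Module LinearMap

variable {H : Type*} [AddCommGroup H] [Module ℂ H]

theorem isPolyHom_comap {W : Type*} [AddCommGroup W] [Module ℂ W] (Ψ : W ≃ₗ[ℂ] H) :
    IsPolyHom (Submodule.comap (Ψ : W →ₗ[ℂ] H)) where
  map_sup := (Submodule.orderIsoMapComap Ψ).symm.map_sup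
  map_inf := (Submodule.orderIsoMapComap Ψ).symm.map_inf
  map_bot := (Submodule.orderIsoMapComap Ψ).symm.map_bot
  map_top := (Submodule.orderIsoMapComap Ψ).symm.map_top

/-- A complete system of orthogonal idempotents, all isomorphic on `D`, identifies the ambient
space with a power of `D`. -/
theorem exists_equiv_of_projections (D : Submodule ℂ H) (π : Fin 4 → H →ₗ[ℂ] H)
    (hsum : ∀ h, π 0 h + π 1 h + π 2 h + π 3 h = h)
    (horth : ∀ i j, i ≠ j → ∀ h, π i (π j h) = 0)
    (hinj : ∀ i, ∀ k ∈ D, π i k = 0 → k = 0) (hsurj : ∀ i h, ∃ k ∈ D, π i k = π i h) :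
    ∃ Ψ : ((D × D) × (D × D)) ≃ₗ[ℂ] H, ∀ a b c d : D,
      π 0 (Ψ ((a, b), (c, d))) = π 0 a ∧ π 1 (Ψ ((a, b), (c, d))) = π 1 b ∧
      π 2 (Ψ ((a, b), (c, d))) = π 2 c ∧ π 3 (Ψ ((a, b), (c, d))) = π 3 d := by
  have hidem : ∀ i h, π i (π i h) = π i h := by
    intro i h
    have := congrArg (π i) (hsum h)
    simp only [map_add] at this
    fin_cases i <;> simpa [horth] using this
  let Φ : ((D × D) × (D × D)) →ₗ[ℂ] H :=
    ((π 0 ∘ₗ D.subtype).coprod (π 1 ∘ₗ D.subtype)).coprod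
      ((π 2 ∘ₗ D.subtype).coprod (π 3 ∘ₗ D.subtype))
  have hΦ : ∀ a b c d : D, Φ ((a, b), (c, d)) = π 0 a + π 1 b + (π 2 c + π 3 d) := by
    intro a b c d
    simp [Φ]
  have hπ : ∀ a b c d : D,
      π 0 (Φ ((a, b), (c, d))) = π 0 a ∧ π 1 (Φ ((a, b), (c, d))) = π 1 b ∧
      π 2 (Φ ((a, b), (c, d))) = π 2 c ∧ π 3 (Φ ((a, b), (c, d))) = π 3 d := by
    intro a b c d
    simp [hΦ, hidem, horth]
  refine ⟨LinearEquiv.ofBijective Φ ⟨?_, ?_⟩, hπ⟩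
  · rw [← LinearMap.ker_eq_bot, LinearMap.ker_eq_bot']
    rintro ⟨⟨a, b⟩, ⟨c, d⟩⟩ h
    have := hπ a b c d
    simp only [h, map_zero] at this
    obtain ⟨ha, hb, hc, hd⟩ := this
    simp [Prod.ext_iff, ← Submodule.coe_eq_zero, hinj 0 a a.2 ha.symm, hinj 1 b b.2 hb.symm,
      hinj 2 c c.2 hc.symm, hinj 3 d d.2 hd.symm]
  · intro h
    obtain ⟨a, ha, ha'⟩ := hsurj 0 h
    obtain ⟨b, hb, hb'⟩ := hsurj 1 h
    obtain ⟨c, hc, hc'⟩ := hsurj 2 h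
    obtain ⟨d, hd, hd'⟩ := hsurj 3 h
    refine ⟨((⟨a, ha⟩, ⟨b, hb⟩), (⟨c, hc⟩, ⟨d, hd⟩)), ?_⟩
    rw [hΦ, ha', hb', hc', hd', ← add_assoc, hsum]

theorem exists_graph {V W : Type*} [AddCommGroup V] [Module ℂ V] [AddCommGroup W] [Module ℂ W]
    {G : Submodule ℂ (V × W)} (hdisj : ∀ w, (0, w) ∈ G → w = 0) (hcod : ∀ v, ∃ w, (v, w) ∈ G) :
    ∃ L : V →ₗ[ℂ] W, G = LinearMap.graph L := by
  refine Submodule.exists_eq_graph ⟨?_, fun v => ?_⟩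
  · rintro ⟨⟨v, w⟩, h⟩ ⟨⟨v', w'⟩, h'⟩ (e : v = v')
    subst e
    have := hdisj (w - w') (by simpa using sub_mem h h')
    simp [sub_eq_zero.1 this]
  · obtain ⟨w, hw⟩ := hcod v
    exact ⟨⟨_, hw⟩, rfl⟩

theorem exists_map_eq_standard (f : Frame (Submodule ℂ H)) (π : Fin 4 → H →ₗ[ℂ] H)
    (hsum : ∀ h, π 0 h + π 1 h + π 2 h + π 3 h = h)
    (horth : ∀ i j, i ≠ j → ∀ h, π i (π j h) = 0)
    (h₁ : range (π 0) = f.e₁) (h₂ : range (π 1) = f.e₂)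
    (h₃ : range (π 2) = f.e₃) (h₄ : range (π 3) = f.e₄)
    (hf : ∀ p ∈ f.frameConds, p.1 ≤ p.2) :
    ∃ (Ψ : ((f.diag × f.diag) × (f.diag × f.diag)) ≃ₗ[ℂ] H)
      (T : Bool → Bool → Bool → End ℂ f.diag),
      f.map (Submodule.comap Ψ.toLinearMap) = standard T := by
  have hmem : ∀ i h, h ∈ range (π i) ↔ ∀ j, j ≠ i → π j h = 0 := by
    intro i h
    constructor
    · rintro ⟨h, rfl⟩ j hj
      exact horth j i hj h
    · intro hj
      refine ⟨h, ?_⟩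
      have := hsum h
      fin_cases i <;> simpa [hj] using this
  have hle : ∀ i j, j ≠ i → range (π j) ≤ ker (π i) := by
    rintro i j hij _ ⟨h, rfl⟩
    exact horth i j hij.symm h
  have hker : ∀ i, ∃ A, (f.diag ⊓ A ≤ ⊥ ∧ ⊤ ≤ f.diag ⊔ A) ∧ A = ker (π i) := by
    have hf' := hf
    simp only [frameConds, List.mem_cons, List.not_mem_nil, or_false, forall_eq_or_imp, forall_eq,
      ← h₁, ← h₂, ← h₃, ← h₄] at hf'
    have hin : ∀ i h, π i h ∈ range (π i) := fun i h => ⟨h, rfl⟩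
    obtain ⟨-, a₁, b₁, a₂, b₂, a₃, b₃, a₄, b₄, -⟩ := hf'
    intro i
    fin_cases i
    · refine ⟨_, ⟨a₁, b₁⟩, le_antisymm ?_ fun h hh => ?_⟩
      · simp [hle]
      · have hh : π 0 h = 0 := hh
        rw [← hsum h, hh, zero_add]
        exact Submodule.add_mem_sup (Submodule.add_mem_sup (hin _ _) (hin _ _)) (hin _ _)
    · refine ⟨_, ⟨a₂, b₂⟩, le_antisymm ?_ fun h hh => ?_⟩
      · simp [hle]
      · have hh : π 1 h = 0 := hh
        rw [← hsum h, hh, add_zero]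
        exact Submodule.add_mem_sup (Submodule.add_mem_sup (hin _ _) (hin _ _)) (hin _ _)
    · refine ⟨_, ⟨a₃, b₃⟩, le_antisymm ?_ fun h hh => ?_⟩
      · simp [hle]
      · have hh : π 2 h = 0 := hh
        rw [← hsum h, hh, add_zero]
        exact Submodule.add_mem_sup (Submodule.add_mem_sup (hin _ _) (hin _ _)) (hin _ _)
    · refine ⟨_, ⟨a₄, b₄⟩, le_antisymm ?_ fun h hh => ?_⟩
      · simp [hle]
      · have hh : π 3 h = 0 := hh
        rw [← hsum h, hh, add_zero]
        exact Submodule.add_mem_sup (Submodule.add_mem_sup (hin _ _) (hin _ _)) (hin _ _)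
  have hinj : ∀ i, ∀ k ∈ f.diag, π i k = 0 → k = 0 := by
    intro i k hk h0
    obtain ⟨A, ⟨hA, -⟩, rfl⟩ := hker i
    exact (Submodule.mem_bot ℂ).1 (hA ⟨hk, h0⟩)
  have hsurj : ∀ i h, ∃ k ∈ f.diag, π i k = π i h := by
    intro i h
    obtain ⟨A, ⟨-, hA⟩, rfl⟩ := hker i
    obtain ⟨k, hk, m, hm, rfl⟩ := Submodule.mem_sup.1 (hA (Submodule.mem_top (x := h)))
    exact ⟨k, hk, by rw [map_add, LinearMap.mem_ker.1 hm, add_zero]⟩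
  obtain ⟨Ψ, hΨ⟩ := exists_equiv_of_projections f.diag π hsum horth hinj hsurj
  have hz : ∀ i (k : f.diag), π i k = 0 ↔ k = 0 := fun i k =>
    ⟨fun h => Submodule.coe_eq_zero.1 (hinj i k k.2 h), fun h => by simp [h]⟩
  have hΨdiag : ∀ k : f.diag, Ψ ((k, k), (k, k)) = k := by
    intro k
    obtain ⟨a, b, c, d⟩ := hΨ k k k k
    rw [← hsum (Ψ _), a, b, c, d, hsum]
  set φ := Submodule.comap Ψ.toLinearMap with hφ
  have he₁ : φ f.e₁ = (standard (V := f.diag) 0).e₁ := by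
    ext ⟨⟨a, b⟩, ⟨c, d⟩⟩
    obtain ⟨ha, hb, hc, hd⟩ := hΨ a b c d
    rw [mem_e₁, hφ, Submodule.mem_comap, ← h₁, hmem]
    simp [Fin.forall_fin_succ, ha, hb, hc, hd, hz]
  have he₂ : φ f.e₂ = (standard (V := f.diag) 0).e₂ := by
    ext ⟨⟨a, b⟩, ⟨c, d⟩⟩
    obtain ⟨ha, hb, hc, hd⟩ := hΨ a b c d
    rw [mem_e₂, hφ, Submodule.mem_comap, ← h₂, hmem]
    simp [Fin.forall_fin_succ, ha, hb, hc, hd, hz]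
  have he₃ : φ f.e₃ = (standard (V := f.diag) 0).e₃ := by
    ext ⟨⟨a, b⟩, ⟨c, d⟩⟩
    obtain ⟨ha, hb, hc, hd⟩ := hΨ a b c d
    rw [mem_e₃, hφ, Submodule.mem_comap, ← h₃, hmem]
    simp [Fin.forall_fin_succ, ha, hb, hc, hd, hz]
  have he₄ : φ f.e₄ = (standard (V := f.diag) 0).e₄ := by
    ext ⟨⟨a, b⟩, ⟨c, d⟩⟩
    obtain ⟨ha, hb, hc, hd⟩ := hΨ a b c d
    rw [mem_e₄, hφ, Submodule.mem_comap, ← h₄, hmem]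
    simp [Fin.forall_fin_succ, ha, hb, hc, hd, hz]
  have hdiag : φ f.diag = (standard (V := f.diag) 0).diag := by
    ext ⟨⟨a, b⟩, ⟨c, d⟩⟩
    rw [mem_diag, hφ, Submodule.mem_comap]
    constructor
    · intro h
      have := Ψ.injective (hΨdiag ⟨_, h⟩)
      simp only [Prod.mk.injEq] at this
      grind
    · rintro ⟨rfl, rfl, rfl⟩
      exact (hΨdiag a).symm ▸ a.2
  have hgraph : ∀ k, ∃ L : (f.diag × f.diag) →ₗ[ℂ] (f.diag × f.diag),
      φ (f.graph k) = LinearMap.graph L := by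
    intro k
    have hk : f.graph k ⊓ (f.e₃ ⊔ f.e₄) ≤ ⊥ ∧ ⊤ ≤ f.graph k ⊔ (f.e₃ ⊔ f.e₄) := by
      cases k <;> exact ⟨hf (_, _) (by simp [frameConds]), hf (_, _) (by simp [frameConds])⟩
    obtain ⟨hd, hc⟩ := hk
    have hd := Submodule.comap_mono (f := Ψ.toLinearMap) hd
    have hc := Submodule.comap_mono (f := Ψ.toLinearMap) hc
    have hom := isPolyHom_comap Ψ
    rw [← hφ] at hd hc hom
    rw [hom.map_inf, hom.map_sup, hom.map_bot, he₃, he₄] at hd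
    rw [hom.map_sup, hom.map_sup, hom.map_top, he₃, he₄, ← sup_assoc] at hc
    refine exists_graph ?_ ?_
    · rintro ⟨c, d⟩ h
      have := hd ⟨h, mem_sup_e₄.2 ⟨0, mem_e₃.2 ⟨rfl, rfl, rfl⟩⟩⟩
      simpa using this
    · rintro ⟨a, b⟩
      obtain ⟨t, ht⟩ := mem_sup_e₄.1 (hc (Submodule.mem_top (x := ((a, b), (0, 0)))))
      obtain ⟨s, hs⟩ := mem_sup_e₃.1 ht
      exact ⟨_, hs⟩
  choose L hL using hgraph
  let T : Bool → Bool → Bool → End ℂ f.diag := fun k i j =>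
    match i, j with
    | false, false => fst ℂ _ _ ∘ₗ L k ∘ₗ inl ℂ _ _
    | true, false => -(fst ℂ _ _ ∘ₗ L k ∘ₗ inr ℂ _ _)
    | false, true => -(snd ℂ _ _ ∘ₗ L k ∘ₗ inl ℂ _ _)
    | true, true => snd ℂ _ _ ∘ₗ L k ∘ₗ inr ℂ _ _
  have hT : ∀ k, φ (f.graph k) = (standard T).graph k := by
    intro k
    rw [hL]
    ext ⟨⟨a, b⟩, ⟨c, d⟩⟩
    have hab : ((a, b) : f.diag × f.diag) = (a, 0) + (0, b) := by simp
    rw [mem_graph, LinearMap.mem_graph_iff, hab, map_add]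
    simp [T, Prod.ext_iff, add_comm]
  refine ⟨Ψ, T, ?_⟩
  change Frame.mk (φ f.e₁) (φ f.e₂) (φ f.e₃) (φ f.e₄) (φ f.diag) (fun k => φ (f.graph k)) = _
  rw [he₁, he₂, he₃, he₄, hdiag]
  simp only [hT]
  rfl

end Coordinatization

end Frame

namespace OLTerm

instance : Max OLTerm := ⟨sup⟩

instance : Min OLTerm := ⟨inf⟩

instance : Bot OLTerm := ⟨zero⟩

instance : Top OLTerm := ⟨one⟩

theorem isPolyHom_eval {d : ℕ} (v : Fin 5 → Submodule ℂ (EuclideanSpace ℂ (Fin d))) :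
    Frame.IsPolyHom (eval v) :=
  ⟨fun _ _ => rfl, fun _ _ => rfl, rfl, rfl⟩

/-- A term that is satisfied exactly if the inequality `p.1 ≤ p.2` is. -/
def hook (p : OLTerm × OLTerm) : OLTerm := p.1.compl ⊔ (p.1 ⊓ p.2)

theorem eval_hook {d : ℕ} {v : Fin 5 → Submodule ℂ (EuclideanSpace ℂ (Fin d))}
    {p : OLTerm × OLTerm} : (hook p).eval v = ⊤ ↔ p.1.eval v ≤ p.2.eval v := by
  change (p.1.eval v)ᗮ ⊔ (p.1.eval v ⊓ p.2.eval v) = ⊤ ↔ _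
  generalize p.1.eval v = A
  generalize p.2.eval v = B
  constructor
  · intro h x hx
    obtain ⟨y, hy, z, hz, rfl⟩ := Submodule.mem_sup.1 (h ▸ Submodule.mem_top (x := x))
    have hyA : y ∈ A := by simpa using A.sub_mem hx hz.1
    rw [(Submodule.mem_bot ℂ).1 (A.inf_orthogonal_eq_bot ▸ ⟨hyA, hy⟩ : y ∈ ⊥), zero_add]
    exact hz.2
  · intro h
    rw [inf_eq_left.2 h, sup_comm, Submodule.sup_orthogonal_of_hasOrthogonalProjection]

theorem eval_foldr_hook {d : ℕ} {v : Fin 5 → Submodule ℂ (EuclideanSpace ℂ (Fin d))}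
    (l : List (OLTerm × OLTerm)) (t : OLTerm) :
    ((l.map hook).foldr (· ⊓ ·) t).eval v = ⊤ ↔
      (∀ p ∈ l.map (Prod.map (eval v) (eval v)), p.1 ≤ p.2) ∧ t.eval v = ⊤ := by
  induction l with
  | nil => simp
  | cons p l ih =>
    rw [List.map_cons, List.foldr_cons, (isPolyHom_eval v).map_inf, inf_eq_top_iff, ih, eval_hook]
    simp [and_assoc]

/-- The frame given by the five variables, with summands that are orthogonal to each other. -/
def frame : Frame OLTerm where
  e₁ := var 0 ⊓ (var 1).compl
  e₂ := var 0 ⊓ var 1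
  e₃ := (var 0).compl ⊓ var 1
  e₄ := (var 0).compl ⊓ (var 1).compl
  diag := var 2
  graph k := bif k then var 4 else var 3

/-- A term that is satisfiable exactly if the rewriting system `R` halts on `c`. -/
def haltingTerm (R : List (StackConfig × StackConfig)) (c : StackConfig) : OLTerm :=
  ((frame.frameConds ++ frame.machineConds R).map hook).foldr (· ⊓ ·) (hook (frame.initCond c))

theorem eval_haltingTerm {d : ℕ} {v : Fin 5 → Submodule ℂ (EuclideanSpace ℂ (Fin d))}
    {R : List (StackConfig × StackConfig)} {c : StackConfig} :
    (haltingTerm R c).eval v = ⊤ ↔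
      (∀ p ∈ (frame.map (eval v)).frameConds, p.1 ≤ p.2) ∧
      (∀ p ∈ (frame.map (eval v)).machineConds R, p.1 ≤ p.2) ∧
      ((frame.map (eval v)).initCond c).1 ≤ ((frame.map (eval v)).initCond c).2 := by
  have h := isPolyHom_eval v
  rw [haltingTerm, eval_foldr_hook, eval_hook, List.map_append, Frame.map_frameConds h,
    Frame.map_machineConds h, ← Frame.map_initCond h, List.forall_mem_append, and_assoc]
  rfl

open Module in
theorem conds_iff_of_map_eq_standard {V H : Type*} [AddCommGroup V] [Module ℂ V]
    [AddCommGroup H] [Module ℂ H] {f : Frame (Submodule ℂ H)}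
    {Ψ : ((V × V) × (V × V)) ≃ₗ[ℂ] H} {T : Bool → Bool → Bool → End ℂ V}
    (hf : f.map (Submodule.comap Ψ.toLinearMap) = Frame.standard T)
    {R : List (StackConfig × StackConfig)} {c : StackConfig} :
    ((∀ p ∈ f.frameConds, p.1 ≤ p.2) ∧ (∀ p ∈ f.machineConds R, p.1 ≤ p.2) ∧
      (f.initCond c).1 ≤ (f.initCond c).2) ↔
    IsHaltingModel R c (T false) (T true false false) (T true false true) (T true true false)
      (T true true true) := by
  have h := Frame.isPolyHom_comap Ψ
  have hle : ∀ {A B : Submodule ℂ H}, A.comap Ψ.toLinearMap ≤ B.comap Ψ.toLinearMap ↔ A ≤ B :=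
    Submodule.comap_le_comap_iff_of_surjective Ψ.surjective
  have hlist : ∀ l : List (Submodule ℂ H × Submodule ℂ H), (∀ p ∈ l, p.1 ≤ p.2) ↔
      ∀ p ∈ l.map (Prod.map (Submodule.comap Ψ.toLinearMap) (Submodule.comap Ψ.toLinearMap)),
        p.1 ≤ p.2 := by
    intro l
    simp only [List.forall_mem_map, Prod.map_fst, Prod.map_snd, hle]
  rw [← Frame.conds_standard, hlist, hlist, Frame.map_frameConds h, Frame.map_machineConds h,
    ← hle, ← hf, ← Frame.map_initCond h]
  exact and_iff_right (hf ▸ Frame.frameConds_standard)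

theorem exists_projections {H : Type*} [NormedAddCommGroup H] [InnerProductSpace ℂ H]
    [FiniteDimensional ℂ H] (e : Fin 4 → Submodule ℂ H) (horth : ∀ i j, i ≠ j → e i ≤ (e j)ᗮ)
    (htop : ⊤ ≤ e 0 ⊔ e 1 ⊔ e 2 ⊔ e 3) :
    ∃ π : Fin 4 → H →ₗ[ℂ] H, (∀ h, π 0 h + π 1 h + π 2 h + π 3 h = h) ∧
      (∀ i j, i ≠ j → ∀ h, π i (π j h) = 0) ∧ ∀ i, LinearMap.range (π i) = e i := by
  have hself : ∀ i, ∀ h ∈ e i, (e i).starProjection h = h := fun i h =>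
    Submodule.starProjection_eq_self_iff.2
  have hzero : ∀ i j, i ≠ j → ∀ h ∈ e j, (e i).starProjection h = 0 := fun i j hij h hh =>
    (Submodule.starProjection_apply_eq_zero_iff _).2 (horth j i hij.symm hh)
  refine ⟨fun i => (e i).starProjection, fun h => ?_, fun i j hij h => ?_, fun i => ?_⟩
  · obtain ⟨x, hx, d, hd, rfl⟩ := Submodule.mem_sup.1 (htop (Submodule.mem_top (x := h)))
    obtain ⟨y, hy, c, hc, rfl⟩ := Submodule.mem_sup.1 hx
    obtain ⟨a, ha, b, hb, rfl⟩ := Submodule.mem_sup.1 hy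
    simp [hself _ _ ha, hself _ _ hb, hself _ _ hc, hself _ _ hd, hzero _ 0 _ a ha,
      hzero _ 1 _ b hb, hzero _ 2 _ c hc, hzero _ 3 _ d hd]
  · exact hzero i j hij _ (Submodule.starProjection_apply_mem _ _)
  · exact Submodule.range_starProjection _

theorem stackHalts_of_eval_eq_top {d : ℕ} (hd : 1 ≤ d)
    {v : Fin 5 → Submodule ℂ (EuclideanSpace ℂ (Fin d))}
    {R : List (StackConfig × StackConfig)} {c : StackConfig}
    (h : (haltingTerm R c).eval v = ⊤) : StackHalts R c := by
  rw [eval_haltingTerm] at h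
  set f := frame.map (eval v)
  have hle : ∀ i, v i ≤ (v i)ᗮᗮ := fun i => Submodule.le_orthogonal_orthogonal _
  have hleft : ∀ {A A' B B' : Submodule ℂ (EuclideanSpace ℂ (Fin d))}, A ≤ A'ᗮ →
      A ⊓ B ≤ (A' ⊓ B')ᗮ := fun h =>
    (inf_le_left.trans h).trans (Submodule.orthogonal_le inf_le_left)
  have hright : ∀ {A A' B B' : Submodule ℂ (EuclideanSpace ℂ (Fin d))}, B ≤ B'ᗮ →
      A ⊓ B ≤ (A' ⊓ B')ᗮ := fun h =>
    (inf_le_right.trans h).trans (Submodule.orthogonal_le inf_le_right)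
  obtain ⟨π, hsum, horth, hrange⟩ := exists_projections ![f.e₁, f.e₂, f.e₃, f.e₄]
    (by
      intro i j hij
      fin_cases i <;> fin_cases j <;> first
        | exact absurd rfl hij
        | exact hleft le_rfl
        | exact hright le_rfl
        | exact hleft (hle _)
        | exact hright (hle _))
    (h.1 (_, _) (by simp [Frame.frameConds]))
  obtain ⟨Ψ, T, hT⟩ := Frame.exists_map_eq_standard f π hsum horth (hrange 0) (hrange 1) (hrange 2)
    (hrange 3) h.1
  have : Nontrivial f.diag := by
    by_contra hn
    rw [not_nontrivial_iff_subsingleton] at hn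
    have : Nonempty (Fin d) := ⟨⟨0, hd⟩⟩
    exact not_subsingleton (EuclideanSpace ℂ (Fin d)) Ψ.symm.toEquiv.subsingleton
  exact ((conds_iff_of_map_eq_standard hT).1 h).stackHalts

/-- A power of a finite-dimensional space is linearly equivalent to a Hilbert space with the
summands orthogonal to each other. -/
theorem exists_equiv_euclideanSpace (V : Type*) [AddCommGroup V] [Module ℂ V]
    [FiniteDimensional ℂ V] [Nontrivial V] :
    ∃ d : ℕ, 1 ≤ d ∧ ∃ (Ψ : ((V × V) × (V × V)) ≃ₗ[ℂ] EuclideanSpace ℂ (Fin d))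
      (q : V → V → ℂ), (∀ x, q 0 x = 0) ∧ (∀ x, q x 0 = 0) ∧ (∀ x, q x x = 0 → x = 0) ∧
      ∀ a b c d a' b' c' d', inner ℂ (Ψ ((a, b), (c, d))) (Ψ ((a', b'), (c', d'))) =
        q a a' + q b b' + (q c c' + q d d') := by
  let β := Module.finBasis ℂ V
  let B := (β.prod β).prod (β.prod β)
  let E := Fintype.equivFin
    ((Fin (Module.finrank ℂ V) ⊕ Fin (Module.finrank ℂ V)) ⊕
      (Fin (Module.finrank ℂ V) ⊕ Fin (Module.finrank ℂ V)))
  refine ⟨_, ?_, (B.reindex E).equivFun ≪≫ₗ (WithLp.linearEquiv 2 ℂ _).symm,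
    fun x y => ∑ i, inner ℂ (β.repr x i) (β.repr y i), by simp, by simp, fun x hx => ?_, ?_⟩
  · have := Module.finrank_pos (R := ℂ) (M := V)
    simp only [Fintype.card_sum, Fintype.card_fin]
    omega
  · have hx' : inner ℂ (WithLp.toLp 2 (β.equivFun x)) (WithLp.toLp 2 (β.equivFun x)) = (0 : ℂ) := hx
    rw [inner_self_eq_zero] at hx'
    have := congrArg (WithLp.linearEquiv 2 ℂ _) hx'
    simpa using this
  · intro a b c d a' b' c' d'
    rw [PiLp.inner_apply, ← E.sum_comp]
    simp [B, Fintype.sum_sum_type]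

theorem exists_eval_eq_top {R : List (StackConfig × StackConfig)} {c : StackConfig}
    (hdet : ∀ c c₁ c₂, StackRewrites R c c₁ → StackRewrites R c c₂ → c₁ = c₂)
    (hlen : ∀ ρ ∈ R, ρ.1.1.length + ρ.1.2.length ≤ ρ.2.1.length + ρ.2.2.length)
    (h : StackHalts R c) :
    ∃ d : ℕ, 1 ≤ d ∧ ∃ v : Fin 5 → Submodule ℂ (EuclideanSpace ℂ (Fin d)),
      (haltingTerm R c).eval v = ⊤ := by
  obtain ⟨n, push, S, C, X, P, hM⟩ := h.exists_isHaltingModel hdet hlen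
  have : Nonempty (BoundedConfig n) := ⟨⟨([], []), n.zero_le⟩⟩
  obtain ⟨d, hd, Ψ, q, hq₀, hq₀', hq, hΨ⟩ := exists_equiv_euclideanSpace (BoundedConfig n →₀ ℂ)
  let T : Bool → Bool → Bool → Module.End ℂ (BoundedConfig n →₀ ℂ) := fun k => bif k then
    fun i j => bif i then (bif j then P else X) else (bif j then C else S) else push
  let std := Frame.standard T
  let v : Fin 5 → Submodule ℂ (EuclideanSpace ℂ (Fin d)) := fun i =>
    (![std.e₁ ⊔ std.e₂, std.e₃ ⊔ std.e₂, std.diag, std.graph false, std.graph true] i).comap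
      Ψ.symm.toLinearMap
  have hv : ∀ i w, Ψ w ∈ v i ↔
      w ∈ ![std.e₁ ⊔ std.e₂, std.e₃ ⊔ std.e₂, std.diag, std.graph false, std.graph true] i := by
    intro i w
    simp [v]
  have hv0 : ∀ a b c d, Ψ ((a, b), (c, d)) ∈ v 0 ↔ c = 0 ∧ d = 0 := by
    intro a b c d
    rw [hv]
    simp [std, Frame.mem_sup_e₂, Frame.mem_e₁]
  have hv1 : ∀ a b c d, Ψ ((a, b), (c, d)) ∈ v 1 ↔ a = 0 ∧ d = 0 := by
    intro a b c d
    rw [hv]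
    simp [std, Frame.mem_sup_e₂, Frame.mem_e₃]
  have hv0' : ∀ a b c d, Ψ ((a, b), (c, d)) ∈ (v 0)ᗮ ↔ a = 0 ∧ b = 0 := by
    intro a b c d
    rw [Submodule.mem_orthogonal]
    constructor
    · intro h
      have ha := h _ ((hv0 a 0 0 0).2 ⟨rfl, rfl⟩)
      have hb := h _ ((hv0 0 b 0 0).2 ⟨rfl, rfl⟩)
      simp only [hΨ, hq₀, add_zero, zero_add] at ha hb
      exact ⟨hq _ ha, hq _ hb⟩
    · rintro ⟨rfl, rfl⟩ u hu
      obtain ⟨⟨⟨a', b'⟩, ⟨c', d'⟩⟩, rfl⟩ := Ψ.surjective u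
      obtain ⟨rfl, rfl⟩ := (hv0 _ _ _ _).1 hu
      simp [hΨ, hq₀, hq₀']
  have hv1' : ∀ a b c d, Ψ ((a, b), (c, d)) ∈ (v 1)ᗮ ↔ b = 0 ∧ c = 0 := by
    intro a b c d
    rw [Submodule.mem_orthogonal]
    constructor
    · intro h
      have hb := h _ ((hv1 0 b 0 0).2 ⟨rfl, rfl⟩)
      have hc := h _ ((hv1 0 0 c 0).2 ⟨rfl, rfl⟩)
      simp only [hΨ, hq₀, add_zero, zero_add] at hb hc
      exact ⟨hq _ hb, hq _ hc⟩
    · rintro ⟨rfl, rfl⟩ u hu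
      obtain ⟨⟨⟨a', b'⟩, ⟨c', d'⟩⟩, rfl⟩ := Ψ.surjective u
      obtain ⟨rfl, rfl⟩ := (hv1 _ _ _ _).1 hu
      simp [hΨ, hq₀, hq₀']
  have he₁ : (v 0 ⊓ (v 1)ᗮ).comap Ψ.toLinearMap = std.e₁ := by
    ext ⟨⟨a, b⟩, ⟨c, d⟩⟩
    simp only [Submodule.mem_comap, Submodule.mem_inf, LinearEquiv.coe_coe, hv0, hv1', std,
      Frame.mem_e₁]
    tauto
  have he₂ : (v 0 ⊓ v 1).comap Ψ.toLinearMap = std.e₂ := by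
    ext ⟨⟨a, b⟩, ⟨c, d⟩⟩
    simp only [Submodule.mem_comap, Submodule.mem_inf, LinearEquiv.coe_coe, hv0, hv1, std,
      Frame.mem_e₂]
    tauto
  have he₃ : ((v 0)ᗮ ⊓ v 1).comap Ψ.toLinearMap = std.e₃ := by
    ext ⟨⟨a, b⟩, ⟨c, d⟩⟩
    simp only [Submodule.mem_comap, Submodule.mem_inf, LinearEquiv.coe_coe, hv0', hv1, std,
      Frame.mem_e₃]
    tauto
  have he₄ : ((v 0)ᗮ ⊓ (v 1)ᗮ).comap Ψ.toLinearMap = std.e₄ := by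
    ext ⟨⟨a, b⟩, ⟨c, d⟩⟩
    simp only [Submodule.mem_comap, Submodule.mem_inf, LinearEquiv.coe_coe, hv0', hv1', std,
      Frame.mem_e₄]
    tauto
  have hdiag : (v 2).comap Ψ.toLinearMap = std.diag := by
    ext w
    exact hv 2 w
  have hgraph : ∀ k, ((frame.graph k).eval v).comap Ψ.toLinearMap = std.graph k := by
    intro k
    ext w
    cases k
    exacts [hv 3 w, hv 4 w]
  have hmap : (frame.map (eval v)).map (Submodule.comap Ψ.toLinearMap) = std := by
    change Frame.mk ((v 0 ⊓ (v 1)ᗮ).comap Ψ.toLinearMap) ((v 0 ⊓ v 1).comap Ψ.toLinearMap)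
      (((v 0)ᗮ ⊓ v 1).comap Ψ.toLinearMap) (((v 0)ᗮ ⊓ (v 1)ᗮ).comap Ψ.toLinearMap)
      ((v 2).comap Ψ.toLinearMap) (fun k => ((frame.graph k).eval v).comap Ψ.toLinearMap) = std
    rw [he₁, he₂, he₃, he₄, hdiag]
    simp only [hgraph]
  exact ⟨d, hd, v, eval_haltingTerm.2 ((conds_iff_of_map_eq_standard hmap).2 hM)⟩

theorem satisfiable_haltingTerm_iff {R : List (StackConfig × StackConfig)} {c : StackConfig}
    (hdet : ∀ c c₁ c₂, StackRewrites R c c₁ → StackRewrites R c c₂ → c₁ = c₂)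
    (hlen : ∀ ρ ∈ R, ρ.1.1.length + ρ.1.2.length ≤ ρ.2.1.length + ρ.2.2.length) :
    (∃ d : ℕ, 1 ≤ d ∧ ∃ v : Fin 5 → Submodule ℂ (EuclideanSpace ℂ (Fin d)),
      (haltingTerm R c).eval v = ⊤) ↔ StackHalts R c :=
  ⟨fun ⟨_, hd, _, h⟩ => stackHalts_of_eval_eq_top hd h, exists_eval_eq_top hdet hlen⟩

/-- Maps between terms that are primitive recursive on codes. -/
def CodePrimrec (h : OLTerm → OLTerm) : Prop :=
  ∃ g : ℕ → ℕ, Primrec g ∧ ∀ t, (h t).code = g t.code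

namespace CodePrimrec

variable {g h : OLTerm → OLTerm}

protected theorem const (t : OLTerm) : CodePrimrec fun _ => t :=
  ⟨fun _ => t.code, Primrec.const _, fun _ => rfl⟩

protected theorem id : CodePrimrec fun t => t :=
  ⟨fun n => n, Primrec.id, fun _ => rfl⟩

theorem comp (hg : CodePrimrec g) (hh : CodePrimrec h) : CodePrimrec fun t => g (h t) := by
  obtain ⟨g', hg', eg⟩ := hg
  obtain ⟨h', hh', eh⟩ := hh
  exact ⟨fun n => g' (h' n), hg'.comp hh', fun t => by rw [eg, eh]⟩

theorem sup (hg : CodePrimrec g) (hh : CodePrimrec h) : CodePrimrec fun t => g t ⊔ h t := by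
  obtain ⟨g', hg', eg⟩ := hg
  obtain ⟨h', hh', eh⟩ := hh
  refine ⟨fun n => 6 * Nat.pair (g' n) (h' n) + 3, ?_, fun t => ?_⟩
  · exact Primrec.nat_add.comp (Primrec.nat_mul.comp (Primrec.const 6)
      (Primrec₂.natPair.comp hg' hh')) (Primrec.const 3)
  · simp only [← eg, ← eh]
    rfl

theorem inf (hg : CodePrimrec g) (hh : CodePrimrec h) : CodePrimrec fun t => g t ⊓ h t := by
  obtain ⟨g', hg', eg⟩ := hg
  obtain ⟨h', hh', eh⟩ := hh
  refine ⟨fun n => 6 * Nat.pair (g' n) (h' n) + 4, ?_, fun t => ?_⟩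
  · exact Primrec.nat_add.comp (Primrec.nat_mul.comp (Primrec.const 6)
      (Primrec₂.natPair.comp hg' hh')) (Primrec.const 4)
  · simp only [← eg, ← eh]
    rfl

theorem hook (t : OLTerm) (hh : CodePrimrec h) : CodePrimrec fun r => OLTerm.hook (t, h r) :=
  (CodePrimrec.const t.compl).sup ((CodePrimrec.const t).inf hh)

theorem app (f : Frame OLTerm) (F : OLTerm) : CodePrimrec (f.app F) :=
  (((((CodePrimrec.id.sup (.const _)).inf (.const _)).sup (.const _)).inf (.const _)).sup
    (.const _)).inf (.const _)

theorem foldr_app (f : Frame OLTerm) (l : List OLTerm) : CodePrimrec fun t => l.foldr f.app t := by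
  induction l with
  | nil => exact .id
  | cons F l ih => exact (app f F).comp ih

theorem iterate (hg : CodePrimrec g) (t : OLTerm) : Primrec fun k => (g^[k] t).code := by
  obtain ⟨g', hg', eg⟩ := hg
  refine (Primrec.nat_iterate .id (.const t.code) (hg'.comp .snd).to₂).of_eq fun k => ?_
  induction k with
  | zero => rfl
  | succ k ih =>
    rw [id, Function.iterate_succ_apply', Function.iterate_succ_apply', eg]
    exact congrArg g' ih

theorem foldr_inf (l : List OLTerm) : CodePrimrec fun t => l.foldr (· ⊓ ·) t := by
  induction l with
  | nil => exact .id
  | cons F l ih => exact (CodePrimrec.const F).inf ih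

end CodePrimrec

theorem foldr_app_flatten (f : Frame OLTerm) (w : List OLTerm) (k : ℕ) (t : OLTerm) :
    (List.replicate k w).flatten.foldr f.app t = (fun t => w.foldr f.app t)^[k] t := by
  induction k with
  | zero => rfl
  | succ k ih =>
    rw [List.replicate_succ, List.flatten_cons, List.foldr_append, ih, Function.iterate_succ_apply']

theorem primrec_code_haltingTerm (R : List (StackConfig × StackConfig)) (s t w u : List Bool) :
    Primrec fun k => (haltingTerm R (s, t ++ ((List.replicate k w).flatten ++ u))).code := by
  have hword : ∀ k, frame.word (s, t ++ ((List.replicate k w).flatten ++ u)) frame.e₂ =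
      (s.map (frame.op false false)).foldr frame.app ((t.map (frame.op false true)).foldr frame.app
        ((fun t => (w.map (frame.op false true)).foldr frame.app t)^[k]
          ((u.map (frame.op false true)).foldr frame.app frame.e₂))) := by
    intro k
    rw [← foldr_app_flatten, Frame.word]
    simp only [List.map_append, List.foldr_append, List.map_flatten, List.map_replicate]
  have houter : CodePrimrec fun ρ =>
      ((frame.frameConds ++ frame.machineConds R).map hook).foldr (· ⊓ ·)
        (hook (frame.kernel (frame.op true false true),
          (s.map (frame.op false false)).foldr frame.app
            ((t.map (frame.op false true)).foldr frame.app ρ))) :=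
    (CodePrimrec.foldr_inf _).comp (CodePrimrec.hook _
      ((CodePrimrec.foldr_app _ _).comp (CodePrimrec.foldr_app _ _)))
  obtain ⟨g, hg, eg⟩ := houter
  refine (hg.comp ((CodePrimrec.foldr_app frame (w.map (frame.op false true))).iterate
    ((u.map (frame.op false true)).foldr frame.app frame.e₂))).of_eq fun k => ?_
  rw [← eg, haltingTerm, Frame.initCond, hword]

end OLTerm

/-- There is no algorithm which, given an ortholattice term
`t` in five variables, decides whether there are a finite `d ≥ 1` and subspaces
`U₁, …, U₅` of the complex Hilbert space `ℂ^d` with `t(U₁,…,U₅) = ℂ^d`. -/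
theorem quantum_satisfiability_undecidable :
    ¬ ∃ f : ℕ → Bool, Computable f ∧
      ∀ t : OLTerm, (f t.code = true ↔
        ∃ d : ℕ, 1 ≤ d ∧ ∃ v : Fin 5 → Submodule ℂ (EuclideanSpace ℂ (Fin d)),
          t.eval v = ⊤) := by
  rintro ⟨f, hf, hcode⟩
  obtain ⟨Γ, Λ, _, _, _, M, S, a, b, hS, hundec⟩ := exists_postTuringMachine_halting
  obtain ⟨R, s, t, w, u, hdet, hlen, hR⟩ := exists_stackRewriting_of_postTuringMachine M S hS a b
  refine hundec (ComputablePred.computable_iff.2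
    ⟨_, hf.comp (OLTerm.primrec_code_haltingTerm R s t w u).to_comp, funext fun k => ?_⟩)
  rw [← hR, ← OLTerm.satisfiable_haltingTerm_iff hdet hlen, hcode]
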